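/- arXiv:1811.05075 — 2 statements merged into one kernel-verified Lean document; each statement's English description precedes it below -/
import Mathlib

section
/- If α ∈ ℝ satisfies α < −log(1−q)/log B or α > −log q/log B, then the level set Ē(μ,α) is empty. -/
open MeasureTheory Filter Set Metric Topology

/-- `moranCyl c w n (x, ℓ)` refines the interval `[x, x + ℓ]` along the binary word `w`,
using the contraction ratio `c k` at step `k` (the first letter of `w` is processed with
index `n`).  The result `(x', ℓ')` describes the interval `[x', x' + ℓ']`. -/
noncomputable def moranCyl (c : ℕ → ℝ) : List Bool → ℕ → ℝ × ℝ → ℝ × ℝ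
  | [], _, st => st
  | bb :: w, n, st =>
      moranCyl c w (n + 1)
        (if bb then (st.1 + st.2 - st.2 / c n, st.2 / c n) else (st.1, st.2 / c n))

/-- The basic interval `I_w` of the Moran construction with ratios `c`. -/
noncomputable def moranI (c : ℕ → ℝ) (w : List Bool) : Set ℝ :=
  Icc (moranCyl c w 1 (0, 1)).1 ((moranCyl c w 1 (0, 1)).1 + (moranCyl c w 1 (0, 1)).2)

/-- The length `|I_w|` of the basic interval `I_w`. -/
noncomputable def moranLen (c : ℕ → ℝ) (w : List Bool) : ℝ :=
  (moranCyl c w 1 (0, 1)).2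

/-- The Moran set `⋂ n ⋃ {I_w : |w| = n}`. -/
noncomputable def moranSet (c : ℕ → ℝ) : Set ℝ :=
  ⋂ n : ℕ, ⋃ w ∈ {w : List Bool | w.length = n}, moranI c w

/-- The mass assigned to the cylinder `I_w` by the Moran measure with weight `r k` for the
letter at step `k`: `cylMass r w 1 1 = μ(I_w)`. -/
noncomputable def cylMass (r : ℕ → ℝ) : List Bool → ℕ → ℝ → ℝ
  | [], _, m => m
  | bb :: w, n, m => cylMass r w (n + 1) (if bb then (1 - r n) * m else r n * m)

/-- Lower local dimension `liminf_{r → 0⁺} log μ(B(x,r)) / log r`. -/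
noncomputable def lowerLocalDim (μ : Measure ℝ) (x : ℝ) : ℝ :=
  liminf (fun rr : ℝ => Real.log (μ (closedBall x rr)).toReal / Real.log rr) (𝓝[>] 0)

/-- Upper local dimension `limsup_{r → 0⁺} log μ(B(x,r)) / log r`. -/
noncomputable def upperLocalDim (μ : Measure ℝ) (x : ℝ) : ℝ :=
  limsup (fun rr : ℝ => Real.log (μ (closedBall x rr)).toReal / Real.log rr) (𝓝[>] 0)

/-- `betaFn ρ C s = -log (ρ^s + (1-ρ)^s) / log C`; so `β₁ = betaFn p A`, `β₂ = betaFn q B`. -/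
noncomputable def betaFn (ρ C : ℝ) (s : ℝ) : ℝ :=
  -Real.log (ρ ^ s + (1 - ρ) ^ s) / Real.log C

/-- The Legendre transform `f^*(α) = inf_s (s α - f(s))`. -/
noncomputable def legendre (f : ℝ → ℝ) (α : ℝ) : ℝ :=
  ⨅ s : ℝ, (s * α - f s)

/-- The modification `β̃₁` of `β₁`, linear on `(0,1)`. -/
noncomputable def betaTilde1 (ρ C : ℝ) (s : ℝ) : ℝ :=
  if s ≤ 0 ∨ 1 ≤ s then betaFn ρ C s
  else (1 - s) * betaFn ρ C 0 + s * betaFn ρ C 1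

/-- `packSup μ X r s` is the supremum of `∑ᵢ μ(B(xᵢ,r))^s` over all finite families of
pairwise disjoint closed balls of radius `r` with centers in `X`. -/
noncomputable def packSup (μ : Measure ℝ) (X : Set ℝ) (rr s : ℝ) : ℝ :=
  sSup {y : ℝ | ∃ t : Finset ℝ, (↑t : Set ℝ) ⊆ X ∧
    (↑t : Set ℝ).Pairwise (fun u v => Disjoint (closedBall u rr) (closedBall v rr)) ∧
    y = ∑ u ∈ t, (μ (closedBall u rr)).toReal ^ s}

lemma moranCyl_append_singleton (c : ℕ → ℝ) (b : Bool) (w : List Bool) (n : ℕ) (st : ℝ × ℝ) :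
    moranCyl c (w ++ [b]) n st =
      (if b then
        ((moranCyl c w n st).1 + (moranCyl c w n st).2 - (moranCyl c w n st).2 / c (n + w.length),
          (moranCyl c w n st).2 / c (n + w.length))
      else ((moranCyl c w n st).1, (moranCyl c w n st).2 / c (n + w.length))) := by
  induction w generalizing n st with
  | nil => simp [moranCyl]
  | cons a w ih =>
    rw [List.cons_append, moranCyl, ih, moranCyl]
    simp only [List.length_cons, show n + 1 + w.length = n + (w.length + 1) by omega]

lemma cylMass_append_singleton (r : ℕ → ℝ) (b : Bool) (w : List Bool) (n : ℕ) (m : ℝ) :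
    cylMass r (w ++ [b]) n m =
      (if b then 1 - r (n + w.length) else r (n + w.length)) * cylMass r w n m := by
  induction w generalizing n m with
  | nil => cases b <;> simp [cylMass]
  | cons a w ih =>
    rw [List.cons_append, cylMass, ih, cylMass]
    simp only [List.length_cons, show n + 1 + w.length = n + (w.length + 1) by omega]

lemma moranLen_eq_prod (c : ℕ → ℝ) (w : List Bool) :
    moranLen c w = ∏ k ∈ Finset.range w.length, (c (k + 1))⁻¹ := by
  induction w using List.reverseRecOn with
  | nil => simp [moranLen, moranCyl]
  | append_singleton w b ih =>
    rw [List.length_append, List.length_singleton, Finset.prod_range_succ, ← ih, moranLen,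
      moranLen, moranCyl_append_singleton, add_comm 1 w.length]
    cases b <;> simp [div_eq_mul_inv]

lemma cylMass_bounds {r : ℕ → ℝ} (h0 : ∀ k, 0 < r (k + 1)) (h2 : ∀ k, r (k + 1) ≤ 1 / 2)
    (w : List Bool) :
    ∏ k ∈ Finset.range w.length, r (k + 1) ≤ cylMass r w 1 1 ∧
      cylMass r w 1 1 ≤ ∏ k ∈ Finset.range w.length, (1 - r (k + 1)) := by
  induction w using List.reverseRecOn with
  | nil => simp [cylMass]
  | append_singleton w b ih =>
    obtain ⟨hl, hu⟩ := ih
    rw [List.length_append, List.length_singleton, Finset.prod_range_succ,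
      Finset.prod_range_succ, cylMass_append_singleton, add_comm 1 w.length]
    have hP : 0 < ∏ k ∈ Finset.range w.length, r (k + 1) := Finset.prod_pos fun k _ => h0 k
    have h0' := h0 w.length
    have h2' := h2 w.length
    cases b
    · simp only [Bool.false_eq_true, if_false]
      constructor <;> nlinarith
    · simp only [if_true]
      constructor <;> nlinarith

/-- Thickening a basic interval by less than half of the minimal gap adds no mass. -/
lemma measure_thickened_moranI_le {B : ℝ} {c r : ℕ → ℝ} (hB2 : 2 < B)
    (hc : ∀ k, B ≤ c (k + 1)) (h0 : ∀ k, 0 < r (k + 1)) (h1 : ∀ k, r (k + 1) ≤ 1 / 2)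
    (μ : Measure ℝ) [IsProbabilityMeasure μ]
    (hμ : ∀ w : List Bool, μ (moranI c w) = ENNReal.ofReal (cylMass r w 1 1))
    (w : List Bool) :
    μ (Icc ((moranCyl c w 1 (0, 1)).1 - (B - 2) / 2 * moranLen c w)
      ((moranCyl c w 1 (0, 1)).1 + moranLen c w + (B - 2) / 2 * moranLen c w)) ≤
      ENNReal.ofReal (cylMass r w 1 1) := by
  induction w using List.reverseRecOn with
  | nil => simpa [cylMass] using prob_le_one
  | append_singleton w b ih =>
    have hmass : 0 < cylMass r w 1 1 :=
      (Finset.prod_pos fun k _ => h0 k).trans_le (cylMass_bounds h0 h1 w).1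
    have hl : 0 < moranLen c w := by
      rw [moranLen_eq_prod]
      exact Finset.prod_pos fun k _ => inv_pos.2 (by linarith [hc k])
    have hcw := hc w.length
    have hl' : 0 < moranLen c w / c (w.length + 1) := div_pos hl (by linarith)
    have hmul : moranLen c w / c (w.length + 1) * c (w.length + 1) = moranLen c w :=
      div_mul_cancel₀ _ (by linarith)
    have hr0 := h0 w.length
    have hr1 := h1 w.length
    have key : ∀ J K : Set ℝ, ∀ a d : ℝ, 0 ≤ a → 0 ≤ d → MeasurableSet K →
        Disjoint J K → J ∪ K ⊆ (Icc ((moranCyl c w 1 (0, 1)).1 - (B - 2) / 2 * moranLen c w)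
          ((moranCyl c w 1 (0, 1)).1 + moranLen c w + (B - 2) / 2 * moranLen c w)) →
        μ K = ENNReal.ofReal d → a + d = cylMass r w 1 1 → μ J ≤ ENNReal.ofReal a := by
      intro J K a d ha hd hK hJK hsub hKd had
      have h := (measure_mono hsub).trans ih
      rw [measure_union hJK hK, hKd, ← had, ENNReal.ofReal_add ha hd] at h
      exact (ENNReal.add_le_add_iff_right ENNReal.ofReal_ne_top).1 h
    have hother := hμ (w ++ [!b])
    unfold moranI at hother
    rw [moranCyl_append_singleton, cylMass_append_singleton, add_comm 1 w.length] at hother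
    rw [moranLen, moranCyl_append_singleton, cylMass_append_singleton, add_comm 1 w.length]
    change μ (Icc _ _) = _ at hother
    have hlen : (moranCyl c w 1 (0, 1)).2 = moranLen c w := rfl
    rw [hlen] at hother ⊢
    generalize (moranCyl c w 1 (0, 1)).1 = y at *
    generalize moranLen c w = l at *
    generalize c (w.length + 1) = C at *
    generalize hv : l / C = v at *
    generalize r (w.length + 1) = s at *
    have hvl : v * B ≤ l := by nlinarith
    cases b
    · refine key _ _ _ _ (by simp; positivity) ?_ measurableSet_Icc ?_ ?_ hother ?_
      · simp; nlinarith
      · simp only [Bool.not_false, Bool.false_eq_true, if_false, if_true]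
        rw [Set.disjoint_left]
        rintro z ⟨h1, h2⟩ ⟨h3, h4⟩
        nlinarith
      · simp only [Bool.not_false, Bool.false_eq_true, if_false, if_true]
        rintro z (⟨h1, h2⟩ | ⟨h1, h2⟩) <;> constructor <;> nlinarith
      · simp; ring
    · refine key _ _ _ _ ?_ (by simp; positivity) measurableSet_Icc ?_ ?_ hother ?_
      · simp; nlinarith
      · simp only [Bool.not_true, Bool.false_eq_true, if_false, if_true]
        rw [Set.disjoint_left]
        rintro z ⟨h1, h2⟩ ⟨h3, h4⟩
        nlinarith
      · simp only [Bool.not_true, Bool.false_eq_true, if_false, if_true]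
        rintro z (⟨h1, h2⟩ | ⟨h1, h2⟩) <;> constructor <;> nlinarith
      · simp; ring

lemma exists_word_of_mem_moranSet {c : ℕ → ℝ} {x : ℝ} (hx : x ∈ moranSet c) (n : ℕ) :
    ∃ w : List Bool, w.length = n ∧ x ∈ moranI c w := by
  simpa [moranSet] using Set.mem_iInter.1 hx n

lemma exists_block {N : ℕ → ℕ} (hN0 : N 0 = 0) (hN : StrictMono N) {n : ℕ} (hn : 0 < n) :
    ∃ i, N i < n ∧ n ≤ N (i + 1) := by
  have hex : ∃ i, n ≤ N i := ⟨n, hN.le_apply⟩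
  classical
  rcases h : Nat.find hex with _ | i
  · have := Nat.find_spec hex
    rw [h] at this
    omega
  · refine ⟨i, not_le.1 (Nat.find_min hex (by omega)), ?_⟩
    rw [← h]
    exact Nat.find_spec hex

/-- A point of the Moran set sees at least the mass `(ρ / A) ^ β` at scale `ρ`. -/
lemma mul_log_sub_le_log_measure_closedBall {A B β : ℝ} {c r : ℕ → ℝ} (hB : 1 < B)
    (hβ0 : 0 ≤ β) (hcB : ∀ k, B ≤ c (k + 1)) (hcA : ∀ k, c (k + 1) ≤ A)
    (h0 : ∀ k, 0 < r (k + 1)) (h1 : ∀ k, r (k + 1) ≤ 1 / 2)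
    (hβ : ∀ k, -Real.log (r (k + 1)) ≤ β * Real.log (c (k + 1)))
    (μ : Measure ℝ) [IsProbabilityMeasure μ]
    (hμ : ∀ w : List Bool, μ (moranI c w) = ENNReal.ofReal (cylMass r w 1 1))
    {x : ℝ} (hx : x ∈ moranSet c) {ρ : ℝ} (hρ0 : 0 < ρ) (hρ1 : ρ < 1) :
    0 < (μ (closedBall x ρ)).toReal ∧
      β * (Real.log ρ - Real.log A) ≤ Real.log (μ (closedBall x ρ)).toReal := by
  have hc0 : ∀ k, 0 < c (k + 1) := fun k => by linarith [hcB k]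
  set L : ℕ → ℝ := fun n => ∏ k ∈ Finset.range n, (c (k + 1))⁻¹ with hL
  have hLpos : ∀ n, 0 < L n := fun n => Finset.prod_pos fun k _ => inv_pos.2 (hc0 k)
  have hLle : ∀ n, L n ≤ (B⁻¹) ^ n := fun n => by
    calc L n ≤ ∏ _k ∈ Finset.range n, B⁻¹ := Finset.prod_le_prod
          (fun k _ => (inv_pos.2 (hc0 k)).le)
          (fun k _ => inv_anti₀ (by linarith) (hcB k))
      _ = _ := by simp
  have hex : ∃ n, L n ≤ ρ := by
    obtain ⟨n, hn⟩ := exists_pow_lt_of_lt_one hρ0 (inv_lt_one_of_one_lt₀ hB)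
    exact ⟨n, (hLle n).trans hn.le⟩
  obtain ⟨n, hn, hn'⟩ : ∃ n, L (n + 1) ≤ ρ ∧ ρ < L n := by
    classical
    rcases h : Nat.find hex with _ | n
    · have := Nat.find_spec hex
      rw [h] at this
      simp [hL] at this
      linarith
    · exact ⟨n, h ▸ Nat.find_spec hex, not_le.1 (Nat.find_min hex (by omega))⟩
  obtain ⟨w, hw, hxw⟩ := exists_word_of_mem_moranSet hx (n + 1)
  have hlen : (moranCyl c w 1 (0, 1)).2 = L (n + 1) := by
    rw [← moranLen, moranLen_eq_prod, hw]
  have hsub : moranI c w ⊆ closedBall x ρ := by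
    intro z hz
    rw [moranI, hlen] at hz hxw
    rw [mem_closedBall, Real.dist_eq, abs_le]
    constructor <;> linarith [hz.1, hz.2, hxw.1, hxw.2]
  have hm := (cylMass_bounds h0 h1 w).1
  rw [hw] at hm
  have hP : 0 < ∏ k ∈ Finset.range (n + 1), r (k + 1) := Finset.prod_pos fun k _ => h0 k
  have hle : ∏ k ∈ Finset.range (n + 1), r (k + 1) ≤ (μ (closedBall x ρ)).toReal := by
    refine hm.trans ?_
    rw [← ENNReal.toReal_ofReal (hP.le.trans hm), ← hμ]
    exact ENNReal.toReal_mono (measure_ne_top _ _) (measure_mono hsub)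
  refine ⟨hP.trans_le hle, le_trans ?_ (Real.log_le_log hP hle)⟩
  have hlogL : ∀ n, Real.log (L n) = -∑ k ∈ Finset.range n, Real.log (c (k + 1)) := fun n => by
    rw [Real.log_prod fun k _ => (inv_pos.2 (hc0 k)).ne', ← Finset.sum_neg_distrib]
    simp
  have h3 : Real.log ρ - Real.log A ≤ Real.log (L (n + 1)) := by
    have := Real.log_le_log hρ0 hn'.le
    rw [hlogL] at this
    rw [hlogL, Finset.sum_range_succ]
    linarith [Real.log_le_log (hc0 n) (hcA n)]
  refine (mul_le_mul_of_nonneg_left h3 hβ0).trans ?_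
  rw [Real.log_prod fun k _ => (h0 k).ne', hlogL, mul_neg, Finset.mul_sum,
    ← Finset.sum_neg_distrib]
  exact Finset.sum_le_sum fun k _ => by linarith [hβ k]

/-- At scales comparable to the length of basic intervals, balls centred in the Moran set
have at most the mass of the heaviest basic interval. -/
lemma measure_closedBall_le_prod {B : ℝ} {c r : ℕ → ℝ} (hB2 : 2 < B)
    (hc : ∀ k, B ≤ c (k + 1)) (h0 : ∀ k, 0 < r (k + 1)) (h1 : ∀ k, r (k + 1) ≤ 1 / 2)
    (μ : Measure ℝ) [IsProbabilityMeasure μ]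
    (hμ : ∀ w : List Bool, μ (moranI c w) = ENNReal.ofReal (cylMass r w 1 1))
    {x : ℝ} (hx : x ∈ moranSet c) (n : ℕ) :
    (μ (closedBall x ((B - 2) / 2 * ∏ k ∈ Finset.range n, (c (k + 1))⁻¹))).toReal ≤
      ∏ k ∈ Finset.range n, (1 - r (k + 1)) := by
  obtain ⟨w, hw, hxw⟩ := exists_word_of_mem_moranSet hx n
  have hJ := measure_thickened_moranI_le hB2 hc h0 h1 μ hμ w
  have hxI : x ∈ Icc (moranCyl c w 1 (0, 1)).1
    ((moranCyl c w 1 (0, 1)).1 + moranLen c w) := hxw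
  have hm := cylMass_bounds h0 h1 w
  have hP : 0 < ∏ k ∈ Finset.range w.length, r (k + 1) := Finset.prod_pos fun k _ => h0 k
  rw [← hw, ← moranLen_eq_prod]
  refine le_trans ?_ hm.2
  refine ENNReal.toReal_le_of_le_ofReal (hP.le.trans hm.1) (le_trans (measure_mono ?_) hJ)
  rw [Real.closedBall_eq_Icc]
  exact Icc_subset_Icc (by linarith [hxI.1]) (by linarith [hxI.2])

/-- if α < −log(1−q)/log B or α > −log q/log B, then the level set
Ē(μ,α) = {x ∈ X : d̄(μ,x) = α} is empty. -/
theorem stmt_7 (A B p q : ℝ) (N : ℕ → ℕ)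
    (hBA : B < A) (hB2 : 2 < B)
    (hp0 : 0 < p) (hp2 : p ≤ 1 / 2) (hq0 : 0 < q) (hq2 : q ≤ 1 / 2)
    (hN0 : N 0 = 0) (hNmono : StrictMono N)
    (hNlim : Tendsto (fun i : ℕ => (N (i + 1) : ℝ) / (N i : ℝ)) atTop atTop)
    (hpq : -Real.log p / Real.log A < -Real.log (1 - q) / Real.log B)
    (c r : ℕ → ℝ)
    (hcA : ∀ i n : ℕ, N (2 * i) < n → n ≤ N (2 * i + 1) → c n = A)
    (hcB : ∀ i n : ℕ, N (2 * i + 1) < n → n ≤ N (2 * i + 2) → c n = B)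
    (hrp : ∀ i n : ℕ, N (2 * i) < n → n ≤ N (2 * i + 1) → r n = p)
    (hrq : ∀ i n : ℕ, N (2 * i + 1) < n → n ≤ N (2 * i + 2) → r n = q)
    (μ : Measure ℝ) [IsProbabilityMeasure μ]
    (hμ : ∀ w : List Bool, μ (moranI c w) = ENNReal.ofReal (cylMass r w 1 1))
    (α : ℝ)
    (hα : α < -Real.log (1 - q) / Real.log B ∨ -Real.log q / Real.log B < α) :
    {x | x ∈ moranSet c ∧ upperLocalDim μ x = α} = (∅ : Set ℝ) := by
  have hA1 : 1 < A := by linarith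
  have hlA : 0 < Real.log A := Real.log_pos hA1
  have hlB : 0 < Real.log B := Real.log_pos (by linarith)
  have hlq : Real.log q ≤ Real.log (1 - q) := Real.log_le_log hq0 (by linarith)
  have hl1q : Real.log (1 - q) < 0 := Real.log_neg (by linarith) (by linarith)
  set b := -Real.log (1 - q) / Real.log B with hb
  set β := -Real.log q / Real.log B with hβdef
  have hb0 : 0 < b := div_pos (by linarith) hlB
  have hbβ : b ≤ β := div_le_div_of_nonneg_right (by linarith) hlB.le
  have hβ0 : 0 ≤ β := by linarith
  have hbB : b * Real.log B = -Real.log (1 - q) := div_mul_cancel₀ _ hlB.ne'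
  have hcr : ∀ k, (c (k + 1) = A ∧ r (k + 1) = p) ∨ (c (k + 1) = B ∧ r (k + 1) = q) := by
    intro k
    obtain ⟨i, h1, h2⟩ := exists_block hN0 hNmono (Nat.succ_pos k)
    rcases Nat.even_or_odd' i with ⟨j, rfl | rfl⟩
    · exact Or.inl ⟨hcA j _ h1 h2, hrp j _ h1 h2⟩
    · exact Or.inr ⟨hcB j _ h1 h2, hrq j _ h1 h2⟩
  have hcge : ∀ k, B ≤ c (k + 1) := fun k => by rcases hcr k with h | h <;> linarith [h.1]
  have hcle : ∀ k, c (k + 1) ≤ A := fun k => by rcases hcr k with h | h <;> linarith [h.1]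
  have hr0 : ∀ k, 0 < r (k + 1) := fun k => by rcases hcr k with h | h <;> linarith [h.2]
  have hr2 : ∀ k, r (k + 1) ≤ 1 / 2 := fun k => by rcases hcr k with h | h <;> linarith [h.2]
  have hβk : ∀ k, -Real.log (r (k + 1)) ≤ β * Real.log (c (k + 1)) := by
    intro k
    rcases hcr k with ⟨h1, h2⟩ | ⟨h1, h2⟩
    · rw [h1, h2, ← div_le_iff₀ hlA]
      linarith
    · rw [h1, h2, ← div_le_iff₀ hlB]
  rw [Set.eq_empty_iff_forall_notMem]
  rintro x ⟨hx, hxα⟩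
  unfold upperLocalDim at hxα
  set f : ℝ → ℝ := fun rr => Real.log (μ (closedBall x rr)).toReal / Real.log rr with hf
  have hball : ∀ {ρ : ℝ}, 0 < ρ → ρ < 1 → _ := fun h0 h1 =>
    mul_log_sub_le_log_measure_closedBall (by linarith) hβ0 hcge hcle hr0 hr2 hβk μ hμ hx h0 h1
  have hsmall : ∀ᶠ ρ : ℝ in 𝓝[>] 0, 0 < ρ ∧ ρ < 1 := Ioo_mem_nhdsGT one_pos
  have hfg : ∀ᶠ ρ : ℝ in 𝓝[>] 0, f ρ ≤ β - β * Real.log A / Real.log ρ := by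
    filter_upwards [hsmall] with ρ hρ
    have hlog := Real.log_neg hρ.1 hρ.2
    have h := (hball hρ.1 hρ.2).2
    rw [show β - β * Real.log A / Real.log ρ = β * (Real.log ρ - Real.log A) / Real.log ρ by
      have := hlog.ne
      field_simp]
    exact div_le_div_of_nonpos_of_le hlog.le h
  have hg : Tendsto (fun ρ : ℝ => β - β * Real.log A / Real.log ρ) (𝓝[>] 0) (𝓝 β) := by
    have := (Real.tendsto_log_nhdsGT_zero.const_div_atBot (β * Real.log A)).const_sub β
    simpa using this
  have hbdd : IsBoundedUnder (· ≤ ·) (𝓝[>] 0) f := hg.isBoundedUnder_le.mono_le hfg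
  have hf0 : ∀ᶠ ρ : ℝ in 𝓝[>] 0, 0 ≤ f ρ := by
    filter_upwards [hsmall] with ρ hρ
    refine div_nonneg_of_nonpos (Real.log_nonpos ENNReal.toReal_nonneg ?_)
      (Real.log_neg hρ.1 hρ.2).le
    exact measureReal_le_one
  have hcob : IsCoboundedUnder (· ≤ ·) (𝓝[>] 0) f :=
    IsBoundedUnder.isCoboundedUnder_le (isBoundedUnder_of_eventually_ge hf0)
  rcases hα with hα | hα
  swap
  · have h := limsup_le_limsup hfg hcob hg.isBoundedUnder_le
    rw [hg.limsup_eq, hxα] at h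
    linarith
  obtain ⟨γ, hγ, hγb⟩ := exists_between (max_lt hα hb0)
  have hαγ := (le_max_left _ _).trans_lt hγ
  have hγ0 := (le_max_right _ _).trans_lt hγ
  suffices hfreq : ∃ᶠ ρ in 𝓝[>] 0, γ ≤ f ρ by
    have := le_limsup_of_frequently_le hfreq hbdd
    linarith
  set κ := (B - 2) / 2 with hκ
  have hκ0 : 0 < κ := by rw [hκ]; linarith
  have hc0 : ∀ k, 0 < c (k + 1) := fun k => by linarith [hcge k]
  set L : ℕ → ℝ := fun n => ∏ k ∈ Finset.range n, (c (k + 1))⁻¹ with hL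
  have hLpos : ∀ n, 0 < L n := fun n => Finset.prod_pos fun k _ => inv_pos.2 (hc0 k)
  have hL0 : Tendsto L atTop (𝓝 0) := by
    refine squeeze_zero (fun n => (hLpos n).le) (fun n => ?_)
      (tendsto_pow_atTop_nhds_zero_of_lt_one (r := B⁻¹) (by positivity)
        (inv_lt_one_of_one_lt₀ (by linarith)))
    calc L n ≤ ∏ _k ∈ Finset.range n, B⁻¹ := Finset.prod_le_prod
          (fun k _ => (inv_pos.2 (hc0 k)).le)
          (fun k _ => inv_anti₀ (by linarith) (hcge k))
      _ = _ := by simp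
  have hodd : Tendsto (fun i : ℕ => 2 * i + 1) atTop atTop :=
    tendsto_atTop_mono (fun i => by rw [id]; omega) tendsto_id
  have hodd' : Tendsto (fun i : ℕ => N (2 * i + 2)) atTop atTop :=
    hNmono.tendsto_atTop.comp (tendsto_atTop_mono (fun i => by rw [id]; omega) tendsto_id)
  have hscale : Tendsto (fun i : ℕ => κ * L (N (2 * i + 2))) atTop (𝓝[>] 0) := by
    refine tendsto_nhdsWithin_iff.2 ⟨?_, .of_forall fun i => mul_pos hκ0 (hLpos _)⟩
    simpa using (hL0.comp hodd').const_mul κ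
  refine hscale.frequently (Eventually.frequently ?_)
  set D := (b - γ) * Real.log B with hD
  have hD0 : 0 < D := mul_pos (by linarith) hlB
  filter_upwards [hscale.eventually hsmall,
    (hNlim.comp hodd).eventually_ge_atTop (γ * (Real.log A + |Real.log κ|) / D + 1)]
    with i hi hratio
  have hM : 0 < N (2 * i + 1) := hN0 ▸ hNmono (by omega : 0 < 2 * i + 1)
  have hMn : N (2 * i + 1) ≤ N (2 * i + 2) := hNmono.monotone (by omega)
  have hlog := Real.log_neg hi.1 hi.2
  have hmass := measure_closedBall_le_prod hB2 hcge hr0 hr2 μ hμ hx (N (2 * i + 2))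
  have hpos := (hball hi.1 hi.2).1
  have hlogmass := Real.log_le_log hpos hmass
  have hMpos : (1 : ℝ) ≤ N (2 * i + 1) := by exact_mod_cast hM
  simp only [Function.comp_apply, show 2 * i + 1 + 1 = 2 * i + 2 by omega] at hratio
  rw [le_div_iff₀ (by linarith)] at hratio
  have hr1 : ∀ k, 0 < 1 - r (k + 1) := fun k => by linarith [hr2 k]
  have hsplit : ∀ u : ℕ → ℝ, ∑ k ∈ Finset.range (N (2 * i + 2)), u k =
      ∑ k ∈ Finset.range (N (2 * i + 1)), u k +
        ∑ k ∈ Finset.Ico (N (2 * i + 1)) (N (2 * i + 2)), u k :=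
    fun u => (Finset.sum_range_add_sum_Ico u hMn).symm
  have hconst : ∀ (u : ℕ → ℝ) (d : ℝ), (∀ k, N (2 * i + 1) ≤ k → k < N (2 * i + 2) → u k = d) →
      ∑ k ∈ Finset.Ico (N (2 * i + 1)) (N (2 * i + 2)), u k =
        ((N (2 * i + 2) : ℝ) - N (2 * i + 1)) * d := by
    intro u d hu
    rw [Finset.sum_congr rfl fun k hk => hu k (Finset.mem_Ico.1 hk).1 (Finset.mem_Ico.1 hk).2]
    simp [Nat.cast_sub hMn]
  have hmassbound : Real.log (∏ k ∈ Finset.range (N (2 * i + 2)), (1 - r (k + 1))) ≤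
      ((N (2 * i + 2) : ℝ) - N (2 * i + 1)) * Real.log (1 - q) := by
    rw [Real.log_prod fun k _ => (hr1 k).ne', hsplit, hconst _ (Real.log (1 - q))]
    · have : ∑ k ∈ Finset.range (N (2 * i + 1)), Real.log (1 - r (k + 1)) ≤ 0 :=
        Finset.sum_nonpos fun k _ => Real.log_nonpos (hr1 k).le (by linarith [hr0 k])
      linarith
    · intro k hk hk'
      rw [hrq i (k + 1) (by omega) (by omega)]
  have hscalebound : -Real.log (L (N (2 * i + 2))) ≤ N (2 * i + 1) * Real.log A +
      ((N (2 * i + 2) : ℝ) - N (2 * i + 1)) * Real.log B := by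
    rw [Real.log_prod fun k _ => (inv_pos.2 (hc0 k)).ne', ← Finset.sum_neg_distrib]
    simp only [Real.log_inv, neg_neg]
    rw [hsplit, hconst _ (Real.log B)]
    · have : ∑ k ∈ Finset.range (N (2 * i + 1)), Real.log (c (k + 1)) ≤
          ∑ _k ∈ Finset.range (N (2 * i + 1)), Real.log A :=
        Finset.sum_le_sum fun k _ => Real.log_le_log (hc0 k) (hcle k)
      simp only [Finset.sum_const, Finset.card_range, nsmul_eq_mul] at this
      linarith
    · intro k hk hk'
      rw [hcB i (k + 1) (by omega) (by omega)]
  change γ ≤ _ / _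
  rw [le_div_iff_of_neg hlog]
  rw [Real.log_mul hκ0.ne' (hLpos _).ne'] at *
  generalize (N (2 * i + 2) : ℝ) = n at *
  generalize (N (2 * i + 1) : ℝ) = M at *
  have hratio' : γ * (Real.log A + |Real.log κ|) * M ≤ (n - M) * D := by
    have h : γ * (Real.log A + |Real.log κ|) / D * M ≤ n - M := by linarith
    calc _ = γ * (Real.log A + |Real.log κ|) / D * M * D := by field_simp
      _ ≤ _ := mul_le_mul_of_nonneg_right h hD0.le
  have habs : -Real.log κ ≤ |Real.log κ| * M :=
    (neg_le_abs _).trans (le_mul_of_one_le_right (abs_nonneg _) hMpos)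
  have h1 := mul_le_mul_of_nonneg_left (add_le_add hscalebound habs) hγ0.le
  have h2 : (n - M) * D = -((n - M) * Real.log (1 - q)) - γ * ((n - M) * Real.log B) := by
    rw [hD]
    linear_combination (n - M) * hbB
  linarith
end

section
/- For every α with −log(1−p)/log A ≤ α ≤ −log p/log A, the Hausdorff dimension of the level set E̲(μ,α) equals the Legendre transform of the modified function β̃1, i.e. dim_H E̲(μ,α) = β̃1^*(α) = inf_{s∈ℝ}(sα − β̃1(s)). -/
open MeasureTheory Filter Set Metric Topology

namespace MoranSpectrum

/-- Length of the basic intervals of level `n`, the contraction at step `k + 1` being `a k`. -/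
noncomputable def ell (a : ℕ → ℝ) (n : ℕ) : ℝ := ∏ k ∈ Finset.range n, (a k)⁻¹

/-- Minus the logarithm of `ell a n`. -/
noncomputable def logLen (a : ℕ → ℝ) (n : ℕ) : ℝ := ∑ k ∈ Finset.range n, Real.log (a k)

/-- The shift of the left endpoint at step `k`. -/
noncomputable def jump (a : ℕ → ℝ) (ω : ℕ → Bool) (k : ℕ) : ℝ :=
  if ω k then ell a k - ell a (k + 1) else 0

/-- Left endpoint of the basic interval of level `n` coded by `ω`. -/
noncomputable def leftEnd (a : ℕ → ℝ) (ω : ℕ → Bool) (n : ℕ) : ℝ :=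
  ∑ k ∈ Finset.range n, jump a ω k

/-- The point coded by `ω`. -/
noncomputable def pt (a : ℕ → ℝ) (ω : ℕ → Bool) : ℝ := ∑' k, jump a ω k

/-- The information `∑ -log` of the weights of the first `n` letters of `ω`. -/
noncomputable def info (b : ℕ → ℝ) (ω : ℕ → Bool) (n : ℕ) : ℝ :=
  ∑ k ∈ Finset.range n, -Real.log (if ω k then 1 - b k else b k)

/-- The prefix of length `n`. -/
def pre (ω : ℕ → Bool) (n : ℕ) : List Bool := (List.range n).map ω

lemma pre_succ (ω : ℕ → Bool) (n : ℕ) : pre ω (n + 1) = pre ω n ++ [ω n] := by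
  simp [pre, List.range_succ]

lemma length_pre (ω : ℕ → Bool) (n : ℕ) : (pre ω n).length = n := by simp [pre]

lemma exists_pre_eq (w : List Bool) : ∃ ω, pre ω w.length = w := by
  refine ⟨fun k => w.getD k false, ?_⟩
  apply List.ext_getElem
  · simp [pre]
  · intro i h1 h2
    simp [pre, h2]

lemma pre_congr {ω ω' : ℕ → Bool} {n : ℕ} (h : ∀ k < n, ω k = ω' k) : pre ω n = pre ω' n := by
  unfold pre
  apply List.map_congr_left
  intro k hk
  exact h k (List.mem_range.1 hk)

lemma moranCyl_append (c : ℕ → ℝ) (w v : List Bool) (n : ℕ) (st : ℝ × ℝ) :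
    moranCyl c (w ++ v) n st = moranCyl c v (n + w.length) (moranCyl c w n st) := by
  induction w generalizing n st with
  | nil => rfl
  | cons x w ih =>
    simp only [List.cons_append, moranCyl, List.length_cons]
    rw [ih]
    congr 1
    omega

lemma cylMass_append (r : ℕ → ℝ) (w v : List Bool) (n : ℕ) (m : ℝ) :
    cylMass r (w ++ v) n m = cylMass r v (n + w.length) (cylMass r w n m) := by
  induction w generalizing n m with
  | nil => rfl
  | cons x w ih =>
    simp only [List.cons_append, cylMass, List.length_cons]
    rw [ih]
    congr 1
    omega

lemma ell_succ (a : ℕ → ℝ) (n : ℕ) : ell a (n + 1) = ell a n / a n := by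
  simp [ell, Finset.prod_range_succ, div_eq_mul_inv, mul_comm]

lemma moranCyl_pre (c : ℕ → ℝ) (ω : ℕ → Bool) (n : ℕ) :
    moranCyl c (pre ω n) 1 (0, 1) =
      (leftEnd (fun k => c (k + 1)) ω n, ell (fun k => c (k + 1)) n) := by
  induction n with
  | zero => simp [pre, moranCyl, leftEnd, ell]
  | succ n ih =>
    rw [pre_succ, moranCyl_append, ih, length_pre]
    have h1 : leftEnd (fun k => c (k + 1)) ω (n + 1) =
        leftEnd (fun k => c (k + 1)) ω n + jump (fun k => c (k + 1)) ω n := by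
      simp [leftEnd, Finset.sum_range_succ]
    rw [h1, ell_succ]
    simp only [moranCyl, jump]
    rw [ell_succ, add_comm 1 n]
    cases ω n
    · simp
    · simp [add_sub_assoc]

lemma moranI_pre (c : ℕ → ℝ) (ω : ℕ → Bool) (n : ℕ) :
    moranI c (pre ω n) = Icc (leftEnd (fun k => c (k + 1)) ω n)
      (leftEnd (fun k => c (k + 1)) ω n + ell (fun k => c (k + 1)) n) := by
  rw [moranI, moranCyl_pre]

lemma cylMass_pre {r : ℕ → ℝ} (h0 : ∀ k, 0 < r (k + 1)) (h1 : ∀ k, r (k + 1) < 1)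
    (ω : ℕ → Bool) (n : ℕ) :
    cylMass r (pre ω n) 1 1 = Real.exp (-info (fun k => r (k + 1)) ω n) := by
  induction n with
  | zero => simp [pre, cylMass, info]
  | succ n ih =>
    rw [pre_succ, cylMass_append, ih, length_pre]
    have h2 := h0 n
    have h3 : 0 < 1 - r (n + 1) := by linarith [h1 n]
    simp only [cylMass, info, Finset.sum_range_succ, neg_add, Real.exp_add, neg_neg, add_comm 1 n]
    cases ω n
    · simp [Real.exp_log h2, mul_comm]
    · simp [Real.exp_log h3, mul_comm]

section Geometry

variable {a : ℕ → ℝ} {B : ℝ}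

lemma ell_eq_exp (ha : ∀ k, 0 < a k) (n : ℕ) : ell a n = Real.exp (-logLen a n) := by
  simp only [ell, logLen, ← Finset.sum_neg_distrib, Real.exp_sum]
  refine Finset.prod_congr rfl fun k _ => ?_
  rw [Real.exp_neg, Real.exp_log (ha k)]

lemma le_logLen (hB : 2 < B) (haB : ∀ k, B ≤ a k) (n : ℕ) : n * Real.log B ≤ logLen a n := by
  have : ∑ k ∈ Finset.range n, Real.log B ≤ logLen a n :=
    Finset.sum_le_sum fun k _ => Real.log_le_log (by linarith) (haB k)
  simpa using this

lemma ell_pos (ha : ∀ k, 0 < a k) (n : ℕ) : 0 < ell a n := by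
  rw [ell_eq_exp ha]; exact Real.exp_pos _

lemma tendsto_logLen (hB : 2 < B) (haB : ∀ k, B ≤ a k) : Tendsto (logLen a) atTop atTop := by
  refine tendsto_atTop_mono (le_logLen hB haB) ?_
  exact tendsto_natCast_atTop_atTop.atTop_mul_const (Real.log_pos (by linarith))

lemma tendsto_ell (hB : 2 < B) (haB : ∀ k, B ≤ a k) : Tendsto (ell a) atTop (𝓝 0) := by
  have ha : ∀ k, 0 < a k := fun k => by linarith [haB k]
  have : ell a = fun n => Real.exp (-logLen a n) := funext (ell_eq_exp ha)
  rw [this]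
  exact Real.tendsto_exp_neg_atTop_nhds_zero.comp (tendsto_logLen hB haB)

lemma ell_succ_le (hB : 2 < B) (haB : ∀ k, B ≤ a k) (n : ℕ) : B * ell a (n + 1) ≤ ell a n := by
  have ha : ∀ k, 0 < a k := fun k => by linarith [haB k]
  have h := ell_pos ha n
  rw [ell_succ, mul_div_assoc', div_le_iff₀ (ha n)]
  nlinarith [haB n]

lemma ell_antitone (hB : 2 < B) (haB : ∀ k, B ≤ a k) : Antitone (ell a) := by
  have ha : ∀ k, 0 < a k := fun k => by linarith [haB k]
  refine antitone_nat_of_succ_le fun n => ?_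
  nlinarith [ell_succ_le hB haB n, ell_pos ha (n + 1)]

lemma jump_nonneg (hB : 2 < B) (haB : ∀ k, B ≤ a k) (ω : ℕ → Bool) (k : ℕ) :
    0 ≤ jump a ω k := by
  unfold jump
  split_ifs
  · exact sub_nonneg.2 (ell_antitone hB haB (Nat.le_succ k))
  · exact le_rfl

lemma jump_le (hB : 2 < B) (haB : ∀ k, B ≤ a k) (ω : ℕ → Bool) (k : ℕ) :
    jump a ω k ≤ ell a k - ell a (k + 1) := by
  unfold jump
  split_ifs
  · exact le_rfl
  · exact sub_nonneg.2 (ell_antitone hB haB (Nat.le_succ k))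

lemma leftEnd_succ (a : ℕ → ℝ) (ω : ℕ → Bool) (n : ℕ) :
    leftEnd a ω (n + 1) = leftEnd a ω n + jump a ω n := by
  simp [leftEnd, Finset.sum_range_succ]

lemma leftEnd_monotone (hB : 2 < B) (haB : ∀ k, B ≤ a k) (ω : ℕ → Bool) :
    Monotone (leftEnd a ω) := by
  refine monotone_nat_of_le_succ fun n => ?_
  rw [leftEnd_succ]
  linarith [jump_nonneg hB haB ω n]

lemma rightEnd_antitone (hB : 2 < B) (haB : ∀ k, B ≤ a k) (ω : ℕ → Bool) :
    Antitone (fun n => leftEnd a ω n + ell a n) := by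
  refine antitone_nat_of_succ_le fun n => ?_
  simp only [leftEnd_succ]
  linarith [jump_le hB haB ω n]

lemma summable_ell_sub (hB : 2 < B) (haB : ∀ k, B ≤ a k) :
    Summable fun k => ell a k - ell a (k + 1) := by
  have ha : ∀ k, 0 < a k := fun k => by linarith [haB k]
  refine summable_of_sum_range_le (c := 1) (fun k => sub_nonneg.2
    (ell_antitone hB haB (Nat.le_succ k))) fun n => ?_
  rw [Finset.sum_range_sub']
  have : ell a 0 = 1 := by simp [ell]
  linarith [ell_pos ha n]

lemma norm_jump_le (hB : 2 < B) (haB : ∀ k, B ≤ a k) (k : ℕ) (ω : ℕ → Bool) :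
    ‖jump a ω k‖ ≤ ell a k - ell a (k + 1) := by
  rw [Real.norm_of_nonneg (jump_nonneg hB haB ω k)]
  exact jump_le hB haB ω k

lemma summable_jump (hB : 2 < B) (haB : ∀ k, B ≤ a k) (ω : ℕ → Bool) :
    Summable (jump a ω) :=
  Summable.of_norm_bounded (summable_ell_sub hB haB) fun k => norm_jump_le hB haB k ω

lemma tendsto_leftEnd (hB : 2 < B) (haB : ∀ k, B ≤ a k) (ω : ℕ → Bool) :
    Tendsto (leftEnd a ω) atTop (𝓝 (pt a ω)) :=
  (summable_jump hB haB ω).hasSum.tendsto_sum_nat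

lemma pt_mem (hB : 2 < B) (haB : ∀ k, B ≤ a k) (ω : ℕ → Bool) (n : ℕ) :
    pt a ω ∈ Icc (leftEnd a ω n) (leftEnd a ω n + ell a n) := by
  constructor
  · exact (leftEnd_monotone hB haB ω).ge_of_tendsto (tendsto_leftEnd hB haB ω) n
  · refine (rightEnd_antitone hB haB ω).le_of_tendsto ?_ n
    simpa using (tendsto_leftEnd hB haB ω).add (tendsto_ell hB haB)

lemma continuous_pt (hB : 2 < B) (haB : ∀ k, B ≤ a k) : Continuous (pt a) := by
  refine continuous_tsum (fun k => ?_) (summable_ell_sub hB haB) (norm_jump_le hB haB)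
  exact (continuous_of_discreteTopology (f := fun x : Bool =>
    if x then ell a k - ell a (k + 1) else 0)).comp (continuous_apply k)

lemma leftEnd_congr {ω ω' : ℕ → Bool} {n : ℕ} (h : ∀ k < n, ω k = ω' k) :
    leftEnd a ω n = leftEnd a ω' n := by
  refine Finset.sum_congr rfl fun k hk => ?_
  simp [jump, h k (Finset.mem_range.1 hk)]

lemma info_congr {b : ℕ → ℝ} {ω ω' : ℕ → Bool} {n : ℕ} (h : ∀ k < n, ω k = ω' k) :
    info b ω n = info b ω' n := by
  refine Finset.sum_congr rfl fun k hk => ?_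
  simp [h k (Finset.mem_range.1 hk)]

/-- Points of distinct basic intervals of level `n + 1` are at distance at least
`(1 - 2 / B) * ell a n`. -/
lemma agree_of_dist_lt (hB : 2 < B) (haB : ∀ k, B ≤ a k) {ω ω' : ℕ → Bool} {n : ℕ} {x y : ℝ}
    (hx : x ∈ Icc (leftEnd a ω (n + 1)) (leftEnd a ω (n + 1) + ell a (n + 1)))
    (hy : y ∈ Icc (leftEnd a ω' (n + 1)) (leftEnd a ω' (n + 1) + ell a (n + 1)))
    (hxy : |x - y| < (1 - 2 / B) * ell a n) : ∀ k < n + 1, ω k = ω' k := by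
  by_contra! hne
  have hex : ∃ k, ω k ≠ ω' k := ⟨hne.choose, hne.choose_spec.2⟩
  obtain ⟨j, hj, hjne⟩ := hne
  classical
  set m := Nat.find hex
  have hm : ω m ≠ ω' m := Nat.find_spec hex
  have hlt : ∀ k < m, ω k = ω' k := fun k hk => not_not.1 (Nat.find_min hex hk)
  have hmn : m ≤ n := le_trans (Nat.find_min' hex hjne) (Nat.lt_succ_iff.1 hj)
  have hle := leftEnd_congr (a := a) hlt
  have l1 := leftEnd_monotone hB haB ω (Nat.succ_le_succ hmn)
  have l2 := leftEnd_monotone hB haB ω' (Nat.succ_le_succ hmn)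
  have r1 := rightEnd_antitone hB haB ω (Nat.succ_le_succ hmn)
  have r2 := rightEnd_antitone hB haB ω' (Nat.succ_le_succ hmn)
  simp only [Nat.succ_eq_add_one, leftEnd_succ] at l1 l2 r1 r2 hx hy
  have hg : (1 - 2 / B) * ell a n ≤ ell a m - 2 * ell a (m + 1) := by
    have h1 := ell_succ_le hB haB m
    have h2 := ell_antitone hB haB hmn
    have h3 : ell a (m + 1) ≤ ell a m / B := by
      rw [le_div_iff₀ (by linarith)]; linarith
    have h4 : 0 ≤ 1 - 2 / B := by
      rw [sub_nonneg, div_le_one (by linarith)]; linarith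
    calc (1 - 2 / B) * ell a n ≤ (1 - 2 / B) * ell a m := by gcongr
      _ = ell a m - 2 * (ell a m / B) := by ring
      _ ≤ _ := by linarith
  have hxy' := abs_lt.1 (hxy.trans_le hg)
  obtain ⟨hx1, hx2⟩ := hx
  obtain ⟨hy1, hy2⟩ := hy
  cases h1 : ω m <;> cases h2 : ω' m
  · exact hm (h1.trans h2.symm)
  · simp only [jump, h1, h2, if_true, Bool.false_eq_true, if_false] at *
    linarith
  · simp only [jump, h1, h2, if_true, Bool.false_eq_true, if_false] at *
    linarith
  · exact hm (h1.trans h2.symm)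

lemma exists_scale (hB : 2 < B) (haB : ∀ k, B ≤ a k) {ρ : ℝ} (hρ : 0 < ρ) {n₀ : ℕ}
    (h : ρ < (1 - 2 / B) * ell a n₀) :
    ∃ n ≥ n₀, (1 - 2 / B) * ell a (n + 1) ≤ ρ ∧ ρ < (1 - 2 / B) * ell a n := by
  have hγ : 0 < 1 - 2 / B := by
    rw [sub_pos, div_lt_one (by linarith)]; linarith
  have hlim : Tendsto (fun n => (1 - 2 / B) * ell a n) atTop (𝓝 0) := by
    simpa using (tendsto_ell hB haB).const_mul (1 - 2 / B)
  have hex : ∃ n, (1 - 2 / B) * ell a (n + 1) ≤ ρ := by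
    obtain ⟨n, hn⟩ := ((hlim.comp (tendsto_add_atTop_nat 1)).eventually_lt_const hρ).exists
    exact ⟨n, hn.le⟩
  classical
  have hfind := Nat.find_spec hex
  have hge : n₀ ≤ Nat.find hex := by
    by_contra! hlt
    have := ell_antitone hB haB (Nat.succ_le_of_lt hlt)
    have h2 : (1 - 2 / B) * ell a n₀ ≤ (1 - 2 / B) * ell a (Nat.find hex + 1) := by
      gcongr
    linarith
  refine ⟨Nat.find hex, hge, hfind, ?_⟩
  rcases Nat.eq_zero_or_pos (Nat.find hex) with h0 | h0
  · have : n₀ = Nat.find hex := by omega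
    rwa [← this]
  · have := Nat.find_min hex (Nat.sub_lt h0 one_pos)
    rw [show Nat.find hex - 1 + 1 = Nat.find hex by omega] at this
    exact not_le.1 this

end Geometry

section LocalDimension

variable {c r : ℕ → ℝ} {B : ℝ}

lemma moranSet_eq_range (hB : 2 < B) (hcB : ∀ k, B ≤ c (k + 1)) :
    moranSet c = range (pt fun k => c (k + 1)) := by
  apply Subset.antisymm
  · intro x hx
    have hclosed : IsClosed (range (pt fun k => c (k + 1))) :=
      (isCompact_range (continuous_pt hB hcB)).isClosed
    rw [← hclosed.closure_eq, Metric.mem_closure_iff]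
    intro ε hε
    obtain ⟨n, hn⟩ := ((tendsto_ell hB hcB).eventually_lt_const hε).exists
    simp only [moranSet, mem_iInter, mem_iUnion] at hx
    obtain ⟨w, hw, hxw⟩ := hx n
    obtain ⟨ω, hω⟩ := exists_pre_eq w
    rw [← hω, show w.length = n from hw, moranI_pre] at hxw
    refine ⟨pt _ ω, mem_range_self ω, ?_⟩
    refine lt_of_le_of_lt ?_ hn
    have := Real.dist_le_of_mem_Icc hxw (pt_mem hB hcB ω n)
    simpa using this
  · rintro _ ⟨ω, rfl⟩
    simp only [moranSet, mem_iInter, mem_iUnion]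
    intro n
    refine ⟨pre ω n, length_pre ω n, ?_⟩
    rw [moranI_pre]
    exact pt_mem hB hcB ω n

lemma measure_moranI_pre {μ : Measure ℝ}
    (hμ : ∀ w : List Bool, μ (moranI c w) = ENNReal.ofReal (cylMass r w 1 1))
    (h0 : ∀ k, 0 < r (k + 1)) (h1 : ∀ k, r (k + 1) < 1) (ω : ℕ → Bool) (n : ℕ) :
    μ (moranI c (pre ω n)) = ENNReal.ofReal (Real.exp (-info (fun k => r (k + 1)) ω n)) := by
  rw [hμ, cylMass_pre h0 h1]

/-- The infinite word which starts with `w` and continues with zeros. -/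
def ext {n : ℕ} (w : Fin n → Bool) (k : ℕ) : Bool := if h : k < n then w ⟨k, h⟩ else false

lemma ext_restrict (ω : ℕ → Bool) (n : ℕ) :
    ∀ k < n, ext (fun i : Fin n => ω i) k = ω k := by
  intro k hk
  simp [ext, hk]

lemma ext_apply {n : ℕ} (w : Fin n → Bool) (i : Fin n) : ext w i = w i := by simp [ext]

/-- The sum over all words of length `n` of the `s`-th powers of their weights. -/
lemma sum_exp_info {b : ℕ → ℝ} (h0 : ∀ k, 0 < b k) (h1 : ∀ k, b k < 1) (s : ℝ) (n : ℕ) :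
    ∑ w : Fin n → Bool, Real.exp (-(s * info b (ext w) n)) =
      ∏ k ∈ Finset.range n, (b k ^ s + (1 - b k) ^ s) := by
  have key : ∀ w : Fin n → Bool, Real.exp (-(s * info b (ext w) n)) =
      ∏ i : Fin n, (if w i then 1 - b i else b i) ^ s := by
    intro w
    rw [info, Finset.mul_sum, ← Finset.sum_neg_distrib, Real.exp_sum, Finset.prod_range]
    refine Finset.prod_congr rfl fun i _ => ?_
    rw [ext_apply, Real.rpow_def_of_pos]
    · congr 1; ring
    · have := h0 i; have := h1 i
      split_ifs <;> linarith
  simp_rw [key]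
  rw [Finset.prod_range]
  have := (Finset.prod_univ_sum (fun _ : Fin n => (Finset.univ : Finset Bool))
    (fun i x => (if x then 1 - b i else b i) ^ s)).symm
  simp only [Fintype.piFinset_univ] at this
  rw [this]
  refine Finset.prod_congr rfl fun i _ => ?_
  simp [add_comm]

lemma measure_iUnion_cylinders {μ : Measure ℝ} (hB : 2 < B) (hcB : ∀ k, B ≤ c (k + 1))
    (hμ : ∀ w : List Bool, μ (moranI c w) = ENNReal.ofReal (cylMass r w 1 1))
    (h0 : ∀ k, 0 < r (k + 1)) (h1 : ∀ k, r (k + 1) < 1) (n : ℕ) :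
    μ (⋃ w : Fin n → Bool, moranI c (pre (ext w) n)) = 1 := by
  have ha : ∀ k, 0 < c (k + 1) := fun k => by linarith [hcB k]
  rw [measure_iUnion]
  · simp_rw [measure_moranI_pre hμ h0 h1]
    rw [tsum_fintype, ← ENNReal.ofReal_sum_of_nonneg fun _ _ => (Real.exp_pos _).le]
    have := sum_exp_info h0 h1 1 n
    simp only [one_mul, Real.rpow_one, add_sub_cancel, Finset.prod_const_one] at this
    rw [this, ENNReal.ofReal_one]
  · intro w w' hne
    rw [Function.onFun, Set.disjoint_left]
    intro x hx hx'
    rw [moranI_pre] at hx hx'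
    rcases n with _ | n
    · exact hne (Subsingleton.elim _ _)
    · refine hne (funext fun i => ?_)
      have := agree_of_dist_lt hB hcB hx hx' (n := n) (by
        rw [sub_self, abs_zero]
        refine mul_pos ?_ (ell_pos ha n)
        rw [sub_pos, div_lt_one (by linarith)]; linarith) i i.2
      rwa [ext_apply, ext_apply] at this
  · intro w
    rw [moranI_pre]
    exact measurableSet_Icc

lemma measure_closedBall_le {μ : Measure ℝ} [IsProbabilityMeasure μ] (hB : 2 < B)
    (hcB : ∀ k, B ≤ c (k + 1))
    (hμ : ∀ w : List Bool, μ (moranI c w) = ENNReal.ofReal (cylMass r w 1 1))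
    (h0 : ∀ k, 0 < r (k + 1)) (h1 : ∀ k, r (k + 1) < 1) (ω : ℕ → Bool) (n : ℕ) {ρ : ℝ}
    (hρ : ρ < (1 - 2 / B) * ell (fun k => c (k + 1)) n) :
    (μ (closedBall (pt (fun k => c (k + 1)) ω) ρ)).toReal ≤
      Real.exp (-info (fun k => r (k + 1)) ω (n + 1)) := by
  set U := ⋃ w : Fin (n + 1) → Bool, moranI c (pre (ext w) (n + 1)) with hU
  have hUm : MeasurableSet U := by
    refine MeasurableSet.iUnion fun w => ?_
    rw [moranI_pre]
    exact measurableSet_Icc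
  have hU1 : μ Uᶜ = 0 := by
    rw [prob_compl_eq_zero_iff hUm]
    exact measure_iUnion_cylinders hB hcB hμ h0 h1 (n + 1)
  have hsub : closedBall (pt (fun k => c (k + 1)) ω) ρ ⊆ moranI c (pre ω (n + 1)) ∪ Uᶜ := by
    intro y hy
    by_cases hyU : y ∈ U
    · left
      obtain ⟨w, hw⟩ := mem_iUnion.1 hyU
      have hw' := hw
      rw [moranI_pre] at hw'
      have hlt : |y - pt (fun k => c (k + 1)) ω| <
          (1 - 2 / B) * ell (fun k => c (k + 1)) n := by
        rw [← Real.dist_eq]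
        exact (mem_closedBall.1 hy).trans_lt hρ
      have := agree_of_dist_lt hB hcB hw' (pt_mem hB hcB ω (n + 1)) hlt
      rwa [pre_congr this] at hw
    · exact Or.inr hyU
  have h3 : μ (closedBall (pt (fun k => c (k + 1)) ω) ρ) ≤
      ENNReal.ofReal (Real.exp (-info (fun k => r (k + 1)) ω (n + 1))) := by
    calc _ ≤ μ (moranI c (pre ω (n + 1)) ∪ Uᶜ) := measure_mono hsub
      _ ≤ μ (moranI c (pre ω (n + 1))) + μ Uᶜ := measure_union_le _ _
      _ = _ := by rw [hU1, add_zero, measure_moranI_pre hμ h0 h1]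
  exact ENNReal.toReal_le_of_le_ofReal (Real.exp_pos _).le h3

lemma le_measure_closedBall {μ : Measure ℝ} [IsProbabilityMeasure μ] (hB : 2 < B)
    (hcB : ∀ k, B ≤ c (k + 1))
    (hμ : ∀ w : List Bool, μ (moranI c w) = ENNReal.ofReal (cylMass r w 1 1))
    (h0 : ∀ k, 0 < r (k + 1)) (h1 : ∀ k, r (k + 1) < 1) (ω : ℕ → Bool) (n : ℕ) :
    Real.exp (-info (fun k => r (k + 1)) ω n) ≤
      (μ (closedBall (pt (fun k => c (k + 1)) ω) (ell (fun k => c (k + 1)) n))).toReal := by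
  rw [← ENNReal.ofReal_le_iff_le_toReal (measure_ne_top _ _), ← measure_moranI_pre hμ h0 h1]
  refine measure_mono fun y hy => ?_
  rw [moranI_pre] at hy
  rw [mem_closedBall]
  have := Real.dist_le_of_mem_Icc hy (pt_mem hB hcB ω n)
  simpa using this

lemma info_le {b : ℕ → ℝ} {δ : ℝ} (hδ : 0 < δ) (h0 : ∀ k, δ ≤ b k) (h1 : ∀ k, b k ≤ 1 - δ)
    (ω : ℕ → Bool) (n : ℕ) : info b ω n ≤ n * (-Real.log δ) := by
  have : info b ω n ≤ ∑ k ∈ Finset.range n, -Real.log δ := by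
    refine Finset.sum_le_sum fun k _ => ?_
    have := h0 k; have := h1 k
    rw [neg_le_neg_iff]
    apply Real.log_le_log hδ
    split_ifs <;> linarith
  simpa using this

/-- The lower local dimension at a coded point in terms of the basic intervals around it. -/
lemma lowerLocalDim_eq_iff {μ : Measure ℝ} [IsProbabilityMeasure μ] (hB : 2 < B)
    (hcB : ∀ k, B ≤ c (k + 1))
    (hμ : ∀ w : List Bool, μ (moranI c w) = ENNReal.ofReal (cylMass r w 1 1))
    {δ : ℝ} (hδ : 0 < δ) (h0 : ∀ k, δ ≤ r (k + 1)) (h1 : ∀ k, r (k + 1) ≤ 1 - δ)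
    (ω : ℕ → Bool) {α : ℝ} :
    lowerLocalDim μ (pt (fun k => c (k + 1)) ω) = α ↔
      ∀ ε > 0, (∀ᶠ n in atTop, (α - ε) * logLen (fun k => c (k + 1)) n ≤
          info (fun k => r (k + 1)) ω n) ∧
        (∃ᶠ n in atTop, info (fun k => r (k + 1)) ω n ≤
          (α + ε) * logLen (fun k => c (k + 1)) n) := by
  set a : ℕ → ℝ := fun k => c (k + 1) with hadef
  set b : ℕ → ℝ := fun k => r (k + 1) with hbdef
  have ha : ∀ k, 0 < a k := fun k => by linarith [hcB k]
  have h0' : ∀ k, 0 < b k := fun k => hδ.trans_le (h0 k)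
  have h1' : ∀ k, b k < 1 := fun k => by have := h1 k; simp only [hbdef]; linarith
  set x := pt a ω
  set M : ℝ → ℝ := fun ρ => (μ (closedBall x ρ)).toReal with hM
  set f : ℝ → ℝ := fun ρ => Real.log (M ρ) / Real.log ρ with hf
  have hγ : 0 < 1 - 2 / B := by
    rw [sub_pos, div_lt_one (by linarith)]; linarith
  have hγ1 : 1 - 2 / B ≤ 1 := by
    have : 0 < 2 / B := by apply div_pos <;> linarith
    linarith
  set K := -Real.log (1 - 2 / B) with hK
  have hK0 : 0 ≤ K := neg_nonneg.2 (Real.log_nonpos hγ.le hγ1)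
  have hLtop := tendsto_logLen hB hcB
  have hM1 : ∀ ρ, M ρ ≤ 1 := fun ρ => by
    have : μ (closedBall x ρ) ≤ 1 := prob_le_one
    exact ENNReal.toReal_le_of_le_ofReal zero_le_one (by simpa using this)
  have hf0 : ∀ᶠ ρ in 𝓝[>] (0 : ℝ), 0 ≤ f ρ := by
    filter_upwards [Ioo_mem_nhdsGT (zero_lt_one' ℝ)] with ρ hρ
    refine div_nonneg_of_nonpos ?_ (Real.log_nonpos hρ.1.le hρ.2.le)
    exact Real.log_nonpos ENNReal.toReal_nonneg (hM1 ρ)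
  have htend : Tendsto (ell a) atTop (𝓝[>] 0) :=
    tendsto_nhdsWithin_iff.2 ⟨tendsto_ell hB hcB, Eventually.of_forall (ell_pos ha)⟩
  have hfell : ∀ᶠ n in atTop, f (ell a n) * logLen a n ≤ info b ω n := by
    filter_upwards [hLtop.eventually_gt_atTop 0] with n hn
    have h2 := le_measure_closedBall hB hcB hμ h0' h1' ω n
    have h3 : -info b ω n ≤ Real.log (M (ell a n)) := by
      rw [← Real.log_exp (-info b ω n)]
      exact Real.log_le_log (Real.exp_pos _) h2
    simp only [hf]
    rw [ell_eq_exp ha n] at h3 ⊢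
    rw [Real.log_exp, div_neg, neg_mul, div_mul_cancel₀ _ hn.ne']
    linarith
  have hbdd : IsBoundedUnder (· ≥ ·) (𝓝[>] (0 : ℝ)) f := ⟨0, hf0⟩
  have hcob : IsCoboundedUnder (· ≥ ·) (𝓝[>] (0 : ℝ)) f := by
    refine IsCoboundedUnder.of_frequently_le (a := -Real.log δ / Real.log B) ?_
    refine htend.frequently (Eventually.frequently ?_)
    filter_upwards [hfell, eventually_gt_atTop 0] with n hn hn0
    have h2 := info_le hδ h0 h1 ω n
    have h3 := le_logLen hB hcB n
    have hlB : 0 < Real.log B := Real.log_pos (by linarith)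
    have hn0' : (0 : ℝ) < n := by exact_mod_cast hn0
    rw [le_div_iff₀ hlB]
    by_contra! hlt
    have h5 : 0 ≤ -Real.log δ := by
      rw [neg_nonneg]; apply Real.log_nonpos hδ.le
      linarith [h0 0, h1 0]
    have h4 : 0 ≤ f (ell a n) := by
      by_contra! h6
      nlinarith
    have : n * (f (ell a n) * Real.log B) ≤ n * -Real.log δ := by
      calc _ = f (ell a n) * (n * Real.log B) := by ring
        _ ≤ f (ell a n) * logLen a n := by gcongr
        _ ≤ _ := hn.trans h2
    have := le_of_mul_le_mul_left this hn0'
    linarith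
  have hscale : ∀ n₀, ∀ᶠ ρ in 𝓝[>] (0 : ℝ), ∃ n ≥ n₀,
      info b ω (n + 1) ≤ f ρ * (logLen a (n + 1) + K) := by
    intro n₀
    filter_upwards [Ioo_mem_nhdsGT (zero_lt_one' ℝ),
      Ioo_mem_nhdsGT (mul_pos hγ (ell_pos ha n₀)), hf0] with ρ hρ1 hρ2 hfρ
    obtain ⟨n, hn, hn1, hn2⟩ := exists_scale hB hcB hρ1.1 hρ2.2
    have hlog : -Real.log ρ ≤ logLen a (n + 1) + K := by
      have := Real.log_le_log (mul_pos hγ (ell_pos ha _)) hn1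
      rw [Real.log_mul hγ.ne' (ell_pos ha _).ne', ell_eq_exp ha, Real.log_exp] at this
      linarith
    have hMle := measure_closedBall_le hB hcB hμ h0' h1' ω n hn2
    refine ⟨n, hn, ?_⟩
    have hMpos : 0 < M ρ := by
      obtain ⟨m, hm⟩ := ((tendsto_ell hB hcB).eventually_lt_const hρ1.1).exists
      refine lt_of_lt_of_le (Real.exp_pos _)
        ((le_measure_closedBall hB hcB hμ h0' h1' ω m).trans ?_)
      exact ENNReal.toReal_mono (measure_ne_top _ _)
        (measure_mono (closedBall_subset_closedBall hm.le))
    have h2 : Real.log (M ρ) ≤ -info b ω (n + 1) := by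
      rw [← Real.log_exp (-info b ω (n + 1))]
      exact Real.log_le_log hMpos hMle
    have hlρ : Real.log ρ < 0 := Real.log_neg hρ1.1 hρ1.2
    have h3 : f ρ * (-Real.log ρ) = -Real.log (M ρ) := by
      simp only [hf]
      rw [mul_neg, div_mul_cancel₀ _ hlρ.ne]
    calc info b ω (n + 1) ≤ -Real.log (M ρ) := by linarith
      _ = f ρ * (-Real.log ρ) := h3.symm
      _ ≤ _ := by gcongr
  change liminf f (𝓝[>] 0) = α ↔ _
  constructor
  · intro hlim ε hε
    constructor
    · have h2 : ∀ᶠ ρ in 𝓝[>] (0 : ℝ), α - ε < f ρ :=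
        eventually_lt_of_lt_liminf (by rw [hlim]; linarith) hbdd
      filter_upwards [htend.eventually h2, hfell, hLtop.eventually_gt_atTop 0] with n hn1 hn2 hn3
      nlinarith
    · rw [frequently_atTop]
      intro n₀
      have h2 : ∃ᶠ ρ in 𝓝[>] (0 : ℝ), f ρ < α + ε / 2 :=
        frequently_lt_of_liminf_lt hcob (by rw [hlim]; linarith)
      obtain ⟨n₁, hn₁⟩ := eventually_atTop.1
        (hLtop.eventually_ge_atTop ((α + ε / 2) * K / (ε / 2)))
      obtain ⟨ρ, hρ, n, hn, hn2⟩ :=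
        (h2.and_eventually (hscale (max n₀ n₁))).exists
      refine ⟨n + 1, by omega, ?_⟩
      have h3 := hn₁ (n + 1) (by omega)
      rw [div_le_iff₀ (by linarith)] at h3
      have h4 : 0 ≤ logLen a (n + 1) := by
        refine le_trans ?_ (le_logLen hB hcB _)
        exact mul_nonneg (Nat.cast_nonneg _) (Real.log_nonneg (by linarith))
      nlinarith
  · intro h
    apply le_antisymm
    · refine le_of_forall_pos_le_add fun ε hε => ?_
      refine liminf_le_of_frequently_le ?_ hbdd
      refine htend.frequently ?_
      refine ((h ε hε).2.and_eventually (hfell.and (hLtop.eventually_gt_atTop 0))).mono ?_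
      rintro n ⟨hn1, hn2, hn3⟩
      exact le_of_mul_le_mul_right (hn2.trans hn1) hn3
    · refine le_of_forall_pos_sub_le fun ε hε => ?_
      refine le_liminf_of_le hcob ?_
      obtain ⟨n₁, hn₁⟩ := eventually_atTop.1 ((h (ε / 2) (by linarith)).1.and
        (hLtop.eventually_gt_atTop (max 0 (α * K / (ε / 2)))))
      filter_upwards [hscale n₁, hf0] with ρ hρ hρ0
      obtain ⟨n, hn, hn2⟩ := hρ
      obtain ⟨h3, h4⟩ := hn₁ (n + 1) (by omega)
      have h5 := (le_max_left _ _).trans_lt h4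
      have h6 := (le_max_right _ _).trans_lt h4
      rw [div_lt_iff₀ (by linarith)] at h6
      by_contra! hlt
      have h7 : f ρ * (logLen a (n + 1) + K) < (α - ε) * (logLen a (n + 1) + K) := by
        apply mul_lt_mul_of_pos_right hlt
        linarith
      nlinarith
end LocalDimension

section UpperBound

variable {a b : ℕ → ℝ} {B : ℝ}

lemma ediam_cylinder_le (hB : 2 < B) (haB : ∀ k, B ≤ a k) (ω : ℕ → Bool) (n : ℕ) :
    ediam (Icc (leftEnd a ω n) (leftEnd a ω n + ell a n)) =
      ENNReal.ofReal (Real.exp (-logLen a n)) := by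
  have ha : ∀ k, 0 < a k := fun k => by linarith [haB k]
  rw [Real.ediam_Icc, add_sub_cancel_left, ell_eq_exp ha]

/-- Covering a set of coded points by the basic intervals of some good levels. -/
lemma dimH_le_of_frequently (hB : 2 < B) (haB : ∀ k, B ≤ a k)
    (h0 : ∀ k, 0 < b k) (h1 : ∀ k, b k < 1) {s θ D η : ℝ} (hD : 0 ≤ D) (hη : 0 < η) (I : Set ℕ)
    (hI : ∀ n ∈ I, Real.exp (-((D - s * θ) * logLen a n)) *
      ∏ k ∈ Finset.range n, (b k ^ s + (1 - b k) ^ s) ≤ Real.exp (-(η * n))) :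
    dimH (pt a '' {ω | ∃ᶠ n in atTop, n ∈ I ∧ s * info b ω n ≤ s * θ * logLen a n}) ≤
      ENNReal.ofReal D := by
  classical
  have ha : ∀ k, 0 < a k := fun k => by linarith [haB k]
  have hγ := tendsto_ell hB haB
  set F := pt a '' {ω | ∃ᶠ n in atTop, n ∈ I ∧ s * info b ω n ≤ s * θ * logLen a n} with hF
  set P : (n : ℕ) → (Fin n → Bool) → Prop := fun n w =>
    n ∈ I ∧ s * info b (ext w) n ≤ s * θ * logLen a n with hP
  let ι : ℕ → Type := fun N => (j : ℕ) × {w : Fin (N + j) → Bool // P (N + j) w}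
  let t : (N : ℕ) → ι N → Set ℝ := fun N i =>
    Icc (leftEnd a (ext i.2.1) (N + i.1)) (leftEnd a (ext i.2.1) (N + i.1) + ell a (N + i.1))
  have hr : Tendsto (fun N => ENNReal.ofReal (ell a N)) atTop (𝓝 0) := by
    simpa using ENNReal.tendsto_ofReal hγ
  have hcov : ∀ N, F ⊆ ⋃ i, t N i := by
    rintro N _ ⟨ω, hω, rfl⟩
    obtain ⟨n, hn, hnI, hnω⟩ := frequently_atTop.1 hω N
    obtain ⟨j, rfl⟩ := Nat.exists_eq_add_of_le hn
    have hext := ext_restrict ω (N + j)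
    refine mem_iUnion.2 ⟨⟨j, fun i => ω i, hnI, ?_⟩, ?_⟩
    · rwa [info_congr hext]
    · have := pt_mem hB haB ω (N + j)
      simpa only [t, leftEnd_congr (a := a) hext] using this
  have hdiam : ∀ N (i : ι N), ediam (t N i) = ENNReal.ofReal (Real.exp (-logLen a (N + i.1))) :=
    fun N i => ediam_cylinder_le hB haB _ _
  have hdiam' : ∀ N (i : ι N), ediam (t N i) ≤ ENNReal.ofReal (ell a N) := by
    intro N i
    rw [hdiam, ← ell_eq_exp ha]
    exact ENNReal.ofReal_le_ofReal (ell_antitone hB haB (Nat.le_add_right _ _))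
  have hlevel : ∀ n, ∑ w : {w : Fin n → Bool // P n w},
      Real.exp (-(D * logLen a n)) ≤ Real.exp (-(η * n)) := by
    intro n
    by_cases hn : n ∈ I
    · calc ∑ w : {w : Fin n → Bool // P n w}, Real.exp (-(D * logLen a n))
          ≤ ∑ w : {w : Fin n → Bool // P n w}, Real.exp (-((D - s * θ) * logLen a n)) *
            Real.exp (-(s * info b (ext w.1) n)) := by
            refine Finset.sum_le_sum fun w _ => ?_
            rw [← Real.exp_add]
            apply Real.exp_le_exp.2
            have := w.2.2
            linarith
        _ ≤ ∑ w : Fin n → Bool, Real.exp (-((D - s * θ) * logLen a n)) *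
            Real.exp (-(s * info b (ext w) n)) := by
            rw [← Finset.sum_subtype (Finset.univ.filter (P n)) (by simp) (fun w =>
              Real.exp (-((D - s * θ) * logLen a n)) * Real.exp (-(s * info b (ext w) n)))]
            exact Finset.sum_le_sum_of_subset_of_nonneg (Finset.subset_univ _)
              fun w _ _ => by positivity
        _ ≤ _ := by
            rw [← Finset.mul_sum, sum_exp_info h0 h1]
            exact hI n hn
    · have : IsEmpty {w : Fin n → Bool // P n w} := ⟨fun w => hn w.2.1⟩
      simp [Real.exp_nonneg]
  have hsum : ∀ N, ∑' i, ediam (t N i) ^ D ≤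
      ENNReal.ofReal (Real.exp (-(η * N)) * (1 - Real.exp (-η))⁻¹) := by
    intro N
    have hq : Real.exp (-η) < 1 := Real.exp_lt_one_iff.2 (by linarith)
    calc ∑' i, ediam (t N i) ^ D
        = ∑' j, ∑' w : {w : Fin (N + j) → Bool // P (N + j) w},
            ENNReal.ofReal (Real.exp (-(D * logLen a (N + j)))) := by
          rw [ENNReal.tsum_sigma']
          refine tsum_congr fun j => tsum_congr fun w => ?_
          rw [hdiam, ENNReal.ofReal_rpow_of_pos (Real.exp_pos _), ← Real.exp_mul]
          congr 2; ring
      _ ≤ ∑' j : ℕ, ENNReal.ofReal (Real.exp (-(η * N)) * Real.exp (-η) ^ j) := by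
          refine ENNReal.tsum_le_tsum fun j => ?_
          rw [tsum_fintype, ← ENNReal.ofReal_sum_of_nonneg fun _ _ => (Real.exp_pos _).le]
          apply ENNReal.ofReal_le_ofReal
          refine (hlevel (N + j)).trans_eq ?_
          rw [← Real.exp_nat_mul, ← Real.exp_add]
          push_cast
          congr 1; ring
      _ = _ := by
          have hs := (hasSum_geometric_of_lt_one (Real.exp_pos (-η)).le hq).mul_left
            (Real.exp (-(η * N)))
          rw [← ENNReal.ofReal_tsum_of_nonneg (fun j => by positivity) hs.summable, hs.tsum_eq]
  have hzero : μH[D] F = 0 := by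
    have hle := Measure.hausdorffMeasure_le_liminf_tsum D F (l := atTop)
      (fun N => ENNReal.ofReal (ell a N)) hr t
      (Eventually.of_forall hdiam') (Eventually.of_forall hcov)
    have hlim : Tendsto (fun N : ℕ => ∑' i, ediam (t N i) ^ D) atTop (𝓝 0) := by
      refine tendsto_of_tendsto_of_tendsto_of_le_of_le tendsto_const_nhds ?_
        (fun _ => zero_le) hsum
      rw [← ENNReal.ofReal_zero]
      apply ENNReal.tendsto_ofReal
      rw [← zero_mul (1 - Real.exp (-η))⁻¹]
      refine Tendsto.mul_const _ (Real.tendsto_exp_neg_atTop_nhds_zero.comp ?_)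
      exact tendsto_natCast_atTop_atTop.const_mul_atTop hη
    rw [hlim.liminf_eq] at hle
    exact le_antisymm hle zero_le
  lift D to NNReal using hD
  rw [ENNReal.ofReal_coe_nnreal]
  exact dimH_le_of_hausdorffMeasure_ne_top (by rw [hzero]; exact ENNReal.zero_ne_top)

end UpperBound

section ProductMeasure

open ProbabilityTheory

/-- The measure on `Bool` giving weight `x` to `false` and `1 - x` to `true`. -/
noncomputable def coin (x : ℝ) : Measure Bool :=
  ENNReal.ofReal x • Measure.dirac false + ENNReal.ofReal (1 - x) • Measure.dirac true

lemma coin_singleton (x : ℝ) (y : Bool) :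
    coin x {y} = ENNReal.ofReal (if y then 1 - x else x) := by
  cases y <;> simp [coin]

lemma isProbabilityMeasure_coin {x : ℝ} (h0 : 0 ≤ x) (h1 : x ≤ 1) :
    IsProbabilityMeasure (coin x) := by
  constructor
  simp only [coin, Measure.coe_add, Measure.coe_smul, Pi.add_apply, Pi.smul_apply, measure_univ,
    smul_eq_mul, mul_one]
  rw [← ENNReal.ofReal_add h0 (by linarith)]
  simp

lemma integral_coin {x : ℝ} (h0 : 0 ≤ x) (h1 : x ≤ 1) (g : Bool → ℝ) :
    ∫ y, g y ∂coin x = x * g false + (1 - x) * g true := by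
  have := isProbabilityMeasure_coin h0 h1
  rw [integral_fintype .of_finite]
  simp only [Fintype.sum_bool, measureReal_def, coin_singleton, if_true, Bool.false_eq_true,
    if_false, smul_eq_mul]
  rw [ENNReal.toReal_ofReal h0, ENNReal.toReal_ofReal (by linarith)]
  ring

lemma infinitePi_coin_cylinder {t : ℕ → ℝ} (h0 : ∀ k, 0 < t k) (h1 : ∀ k, t k < 1)
    (ω : ℕ → Bool) (n : ℕ) :
    Measure.infinitePi (fun k => coin (t k)) {ω' | ∀ k < n, ω' k = ω k} =
      ENNReal.ofReal (Real.exp (-info t ω n)) := by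
  have := fun k => isProbabilityMeasure_coin (h0 k).le (h1 k).le
  have hset : {ω' : ℕ → Bool | ∀ k < n, ω' k = ω k} =
      Set.pi (Finset.range n : Set ℕ) (fun k => {ω k}) := by
    ext ω'
    simp [Set.mem_pi]
  rw [hset, Measure.infinitePi_pi _ fun _ _ => measurableSet_singleton _]
  simp only [coin_singleton]
  have hpos : ∀ k, 0 < if ω k then 1 - t k else t k := by
    intro k
    have := h0 k; have := h1 k
    split_ifs <;> linarith
  rw [← ENNReal.ofReal_prod_of_nonneg fun k _ => (hpos k).le]
  congr 1
  rw [info, ← Finset.sum_neg_distrib, Real.exp_sum]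
  refine Finset.prod_congr rfl fun k _ => ?_
  rw [neg_neg, Real.exp_log (hpos k)]

lemma ae_eventually_sum_lt {t : ℕ → ℝ} (h0 : ∀ k, 0 < t k) (h1 : ∀ k, t k < 1)
    {g : ℕ → Bool → ℝ} {u K : ℝ} (hu : ∀ k y, g k y ∈ Icc u K) {ε : ℝ} (hε : 0 < ε) :
    ∀ᵐ ω ∂Measure.infinitePi (fun k => coin (t k)), ∀ᶠ n : ℕ in atTop,
      ∑ k ∈ Finset.range n, (g k (ω k) - (t k * g k false + (1 - t k) * g k true)) < ε * n := by
  have hprob := fun k => isProbabilityMeasure_coin (h0 k).le (h1 k).le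
  set ν := Measure.infinitePi (fun k => coin (t k)) with hν
  set X : ℕ → (ℕ → Bool) → ℝ :=
    fun k ω => g k (ω k) - (t k * g k false + (1 - t k) * g k true) with hX
  set v : NNReal := (‖K - u‖₊ / 2) ^ 2 with hv
  have hindep : iIndepFun X ν :=
    iIndepFun_infinitePi (P := fun k => coin (t k))
      (X := fun k y => g k y - (t k * g k false + (1 - t k) * g k true))
      (fun k => measurable_of_countable _)
  have hsub : ∀ k, HasSubgaussianMGF (X k) v ν := by
    intro k
    have hm : AEMeasurable (fun ω : ℕ → Bool => g k (ω k)) ν :=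
      ((measurable_of_countable (g k)).comp (measurable_pi_apply k)).aemeasurable
    have := hasSubgaussianMGF_of_mem_Icc hm (ae_of_all _ fun ω => hu k (ω k))
    have h_int : ∫ ω, g k (ω k) ∂ν = t k * g k false + (1 - t k) * g k true := by
      rw [← integral_coin (h0 k).le (h1 k).le,
        ← Measure.infinitePi_map_eval (fun k => coin (t k)) k,
        integral_map (measurable_pi_apply k).aemeasurable
        (measurable_of_countable (g k)).aestronglyMeasurable]
    rwa [h_int] at this
  have hbound : ∀ n : ℕ, ν {ω | ε * n ≤ ∑ k ∈ Finset.range n, X k ω} ≤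
      ENNReal.ofReal (Real.exp (-(ε ^ 2 / (2 * (v + 1)))) ^ n) := by
    intro n
    have hsub' : ∀ k, HasSubgaussianMGF (X k) (v + 1) ν := fun k => by
      refine ⟨(hsub k).integrable_exp_mul, fun x => ((hsub k).mgf_le x).trans ?_⟩
      apply Real.exp_le_exp.2
      push_cast
      nlinarith [sq_nonneg x]
    have h := HasSubgaussianMGF.measure_sum_range_ge_le_of_iIndepFun (n := n) hindep
      (fun i _ => hsub' i) (ε := ε * n) (by positivity)
    rw [measureReal_def] at h
    rw [← ENNReal.ofReal_toReal (measure_ne_top ν _)]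
    refine ENNReal.ofReal_le_ofReal (h.trans_eq ?_)
    rw [← Real.exp_nat_mul]
    congr 1
    push_cast
    rcases Nat.eq_zero_or_pos n with rfl | hn
    · simp
    · field_simp
  have hsum : ∑' n : ℕ, ν {ω | ε * n ≤ ∑ k ∈ Finset.range n, X k ω} ≠ ⊤ := by
    refine ne_top_of_le_ne_top ?_ (ENNReal.tsum_le_tsum hbound)
    have hq : Real.exp (-(ε ^ 2 / (2 * (v + 1)))) < 1 := by
      apply Real.exp_lt_one_iff.2
      have : 0 < ε ^ 2 / (2 * ((v : ℝ) + 1)) := by positivity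
      linarith
    rw [← ENNReal.ofReal_tsum_of_nonneg (fun n => by positivity)
      (summable_geometric_of_lt_one (Real.exp_pos _).le hq)]
    exact ENNReal.ofReal_ne_top
  filter_upwards [ae_eventually_notMem hsum] with ω hω
  filter_upwards [hω] with n hn
  exact not_le.1 hn

/-- The cross entropy of the weights `(x, 1 - x)` relative to the weights `(y, 1 - y)`. -/
noncomputable def crossEnt (x y : ℝ) : ℝ := x * -Real.log y + (1 - x) * -Real.log (1 - y)

lemma ae_info_sub_lt {t b : ℕ → ℝ} (h0 : ∀ k, 0 < t k) (h1 : ∀ k, t k < 1)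
    {δ : ℝ} (hδ : 0 < δ) (hb0 : ∀ k, δ ≤ b k) (hb1 : ∀ k, b k ≤ 1 - δ) {ε : ℝ} (hε : 0 < ε) :
    ∀ᵐ ω ∂Measure.infinitePi (fun k => coin (t k)), ∀ᶠ n : ℕ in atTop,
      |info b ω n - ∑ k ∈ Finset.range n, crossEnt (t k) (b k)| < ε * n := by
  have hmem : ∀ k (y : Bool), -Real.log (if y then 1 - b k else b k) ∈ Icc 0 (-Real.log δ) := by
    intro k y
    have := hb0 k; have := hb1 k
    constructor
    · rw [neg_nonneg]
      apply Real.log_nonpos <;> split_ifs <;> linarith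
    · rw [neg_le_neg_iff]
      apply Real.log_le_log hδ
      split_ifs <;> linarith
  have hmem' : ∀ k (y : Bool), - -Real.log (if y then 1 - b k else b k) ∈
      Icc (- -Real.log δ) 0 := fun k y =>
    ⟨neg_le_neg (hmem k y).2, neg_nonpos.2 (hmem k y).1⟩
  filter_upwards [ae_eventually_sum_lt h0 h1 hmem hε, ae_eventually_sum_lt h0 h1 hmem' hε]
    with ω hω1 hω2
  filter_upwards [hω1, hω2] with n hn1 hn2
  have e1 : ∑ k ∈ Finset.range n, (-Real.log (if ω k then 1 - b k else b k) -
      (t k * -Real.log (if false then 1 - b k else b k) +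
        (1 - t k) * -Real.log (if true then 1 - b k else b k))) =
      info b ω n - ∑ k ∈ Finset.range n, crossEnt (t k) (b k) := by
    rw [Finset.sum_sub_distrib]
    simp [info, crossEnt]
  have e2 : ∑ k ∈ Finset.range n, (- -Real.log (if ω k then 1 - b k else b k) -
      (t k * - -Real.log (if false then 1 - b k else b k) +
        (1 - t k) * - -Real.log (if true then 1 - b k else b k))) =
      -(info b ω n - ∑ k ∈ Finset.range n, crossEnt (t k) (b k)) := by
    rw [← e1, ← Finset.sum_neg_distrib]
    exact Finset.sum_congr rfl fun k _ => by ring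
  simp only [Bool.false_eq_true] at e1 e2 hn1 hn2
  rw [e1] at hn1
  rw [e2] at hn2
  exact abs_lt.2 ⟨by linarith, hn1⟩

end ProductMeasure

section LowerBound

variable {a : ℕ → ℝ} {B : ℝ}

/-- Mass distribution principle for sets of coded points. -/
lemma le_dimH_of_ae (hB : 2 < B) (haB : ∀ k, B ≤ a k) {t : ℕ → ℝ}
    (h0 : ∀ k, 0 < t k) (h1 : ∀ k, t k < 1) {S : Set ℝ} {d : ℝ}
    (hS : ∀ᵐ ω ∂Measure.infinitePi (fun k => coin (t k)), pt a ω ∈ S)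
    (hd : ∀ ε > 0, ∀ᵐ ω ∂Measure.infinitePi (fun k => coin (t k)), ∀ᶠ n : ℕ in atTop,
      (d - ε) * logLen a n ≤ info t ω n) :
    ENNReal.ofReal d ≤ dimH S := by
  have ha : ∀ k, 0 < a k := fun k => by linarith [haB k]
  have hprob := fun k => isProbabilityMeasure_coin (h0 k).le (h1 k).le
  set ν := Measure.infinitePi (fun k => coin (t k)) with hν
  have hγ : 0 < 1 - 2 / B := by
    rw [sub_pos, div_lt_one (by linarith)]; linarith
  refine ENNReal.le_of_forall_nnreal_lt fun e he => ?_
  have hed : (e : ℝ) < d := by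
    rwa [← ENNReal.ofReal_coe_nnreal, ENNReal.ofReal_lt_ofReal_iff_of_nonneg e.coe_nonneg] at he
  rcases eq_or_lt_of_le (zero_le (a := e)) with rfl | hepos
  · simp
  have hepos' : (0 : ℝ) < e := hepos
  have hae := hd (d - e) (by linarith)
  simp only [sub_sub_cancel] at hae
  set H : ℕ → Set (ℕ → Bool) := fun m => {ω | ∀ n ≥ m, e * logLen a n ≤ info t ω n} with hH
  obtain ⟨m, hm⟩ : ∃ m, ν (H m) ≠ 0 := by
    by_contra! hzero
    have hU : ν (⋃ m, H m) = 0 := measure_iUnion_null hzero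
    have h2 : ∀ᵐ ω ∂ν, ω ∈ ⋃ m, H m := by
      filter_upwards [hae] with ω hω
      obtain ⟨m, hm⟩ := eventually_atTop.1 hω
      exact mem_iUnion.2 ⟨m, hm⟩
    have h3 : ν (⋃ m, H m)ᶜ = 0 := h2
    have h4 := measure_union_le (μ := ν) (⋃ m, H m) (⋃ m, H m)ᶜ
    rw [union_compl_self, hU, h3, measure_univ] at h4
    simp at h4
  set C : NNReal := Real.toNNReal ((1 - 2 / B) ^ (e : ℝ)) with hC
  have hC0 : C ≠ 0 := by
    rw [hC, Ne, Real.toNNReal_eq_zero, not_le]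
    positivity
  set κ : Measure ℝ := C • (ν.restrict (H m)).map (pt a) with hκ
  have hcont := continuous_pt hB haB
  have hcyl : ∀ (s : Set ℝ) (n : ℕ), m ≤ n + 1 → ediam s < ENNReal.ofReal ((1 - 2 / B) * ell a n) →
      ν.restrict (H m) (pt a ⁻¹' closure s) ≤
        ENNReal.ofReal (Real.exp (-(e * logLen a (n + 1)))) := by
    intro s n hn hs
    rw [Measure.restrict_apply (isClosed_closure.preimage hcont).measurableSet]
    rcases (pt a ⁻¹' closure s ∩ H m).eq_empty_or_nonempty with hem | ⟨ω, hω, hωH⟩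
    · rw [hem, measure_empty]; exact zero_le
    · calc ν (pt a ⁻¹' closure s ∩ H m) ≤ ν {ω' | ∀ k < n + 1, ω' k = ω k} := by
            refine measure_mono fun ω' hω' => ?_
            refine agree_of_dist_lt hB haB (pt_mem hB haB ω' (n + 1)) (pt_mem hB haB ω (n + 1)) ?_
            have h2 : edist (pt a ω') (pt a ω) < ENNReal.ofReal ((1 - 2 / B) * ell a n) := by
              refine (Metric.edist_le_ediam_of_mem (show pt a ω' ∈ closure s from hω'.1)
                hω).trans_lt ?_
              rwa [Metric.ediam_closure]
            rw [edist_dist, ENNReal.ofReal_lt_ofReal_iff_of_nonneg dist_nonneg, Real.dist_eq] at h2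
            exact h2
        _ = ENNReal.ofReal (Real.exp (-info t ω (n + 1))) := infinitePi_coin_cylinder h0 h1 ω _
        _ ≤ _ := by
            apply ENNReal.ofReal_le_ofReal
            apply Real.exp_le_exp.2
            exact neg_le_neg (hωH _ hn)
  have hκle : κ ≤ μH[(e : ℝ)] := by
    refine Measure.le_hausdorffMeasure _ _ (ENNReal.ofReal ((1 - 2 / B) * ell a m / 2)) ?_ ?_
    · rw [ENNReal.ofReal_pos]
      have := ell_pos ha m
      positivity
    intro s hs
    have hmap : κ s ≤ C * ν.restrict (H m) (pt a ⁻¹' closure s) := by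
      refine (measure_mono subset_closure).trans ?_
      rw [hκ, Measure.smul_apply, Measure.map_apply hcont.measurable isClosed_closure.measurableSet]
      rfl
    refine hmap.trans ?_
    have hsfin : ediam s ≠ ⊤ := ne_top_of_le_ne_top ENNReal.ofReal_ne_top hs
    have hmpos : 0 < (1 - 2 / B) * ell a m := mul_pos hγ (ell_pos ha m)
    have key : ∀ ρ : ℝ, 0 < ρ → ediam s ≤ ENNReal.ofReal ρ → ρ < (1 - 2 / B) * ell a m →
        C * ν.restrict (H m) (pt a ⁻¹' closure s) ≤ ENNReal.ofReal ρ ^ (e : ℝ) := by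
      intro ρ hρ hsρ hρm
      obtain ⟨n, hn, hn1, hn2⟩ := exists_scale hB haB hρ hρm
      have h2 := hcyl s n (by omega) (hsρ.trans_lt
        ((ENNReal.ofReal_lt_ofReal_iff_of_nonneg hρ.le).2 hn2))
      calc C * ν.restrict (H m) (pt a ⁻¹' closure s)
          ≤ C * ENNReal.ofReal (Real.exp (-(e * logLen a (n + 1)))) := by gcongr
        _ = ENNReal.ofReal (((1 - 2 / B) * ell a (n + 1)) ^ (e : ℝ)) := by
            have : (C : ENNReal) = ENNReal.ofReal ((1 - 2 / B) ^ (e : ℝ)) := rfl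
            rw [this, ← ENNReal.ofReal_mul (by positivity),
              Real.mul_rpow hγ.le (ell_pos ha _).le, ell_eq_exp ha, ← Real.exp_mul]
            congr 3; ring
        _ ≤ ENNReal.ofReal (ρ ^ (e : ℝ)) := by
            apply ENNReal.ofReal_le_ofReal
            apply Real.rpow_le_rpow _ hn1 hepos'.le
            have := ell_pos ha (n + 1)
            positivity
        _ = _ := (ENNReal.ofReal_rpow_of_pos hρ).symm
    rcases eq_or_ne (ediam s) 0 with hzero | hne
    · rw [hzero, ENNReal.zero_rpow_of_pos hepos']
      have hlim : Tendsto (fun ρ : ℝ => ENNReal.ofReal ρ ^ (e : ℝ)) (𝓝[>] 0) (𝓝 0) := by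
        have h3 : Tendsto (fun ρ : ℝ => ENNReal.ofReal ρ ^ (e : ℝ)) (𝓝 0)
            (𝓝 (ENNReal.ofReal 0 ^ (e : ℝ))) :=
          (ENNReal.continuous_rpow_const.comp ENNReal.continuous_ofReal).tendsto 0
        rw [ENNReal.ofReal_zero, ENNReal.zero_rpow_of_pos hepos'] at h3
        exact h3.mono_left nhdsWithin_le_nhds
      refine ge_of_tendsto hlim ?_
      filter_upwards [Ioo_mem_nhdsGT hmpos] with ρ hρ
      exact key ρ hρ.1 (by rw [hzero]; exact zero_le) hρ.2
    · have h2 := ENNReal.toReal_pos hne hsfin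
      have h3 := key (ediam s).toReal h2 (by rw [ENNReal.ofReal_toReal hsfin]) (by
        have := ENNReal.toReal_le_of_le_ofReal (by positivity) hs
        linarith)
      rwa [ENNReal.ofReal_toReal hsfin] at h3
  apply le_dimH_of_hausdorffMeasure_ne_zero
  have hκS : κ S ≠ 0 := by
    have h2 : ν.restrict (H m) (pt a ⁻¹' S) ≠ 0 := by
      have h3 : ν (pt a ⁻¹' S ∩ H m) = ν (H m) := by
        rw [inter_comm]
        exact measure_inter_conull hS
      have h4 := Measure.le_restrict_apply (μ := ν) (H m) (pt a ⁻¹' S)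
      rw [h3] at h4
      intro h5
      rw [h5] at h4
      exact hm (le_antisymm h4 zero_le)
    have h3 := Measure.le_map_apply (μ := ν.restrict (H m)) hcont.measurable.aemeasurable S
    rw [hκ, Measure.smul_apply]
    intro h4
    have h5 : (C : ENNReal) * (ν.restrict (H m)).map (pt a) S = 0 := h4
    rcases mul_eq_zero.1 h5 with h6 | h6
    · exact hC0 (by exact_mod_cast h6)
    · rw [h6] at h3
      exact h2 (le_antisymm h3 zero_le)
  intro h
  exact hκS (le_antisymm ((hκle S).trans_eq h) zero_le)

end LowerBound

/-- The sequences `a` and `b` take the values `A, p` and `B, q` on alternating blocks whose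
lengths grow faster than any geometric sequence. -/
structure AlternatingBlocks (A B p q : ℝ) (N : ℕ → ℕ) (a b : ℕ → ℝ) : Prop where
  lt : B < A
  two_lt : 2 < B
  p_pos : 0 < p
  p_le : p ≤ 1 / 2
  q_pos : 0 < q
  q_le : q ≤ 1 / 2
  zero : N 0 = 0
  mono : StrictMono N
  lim : Tendsto (fun i : ℕ => (N (i + 1) : ℝ) / (N i : ℝ)) atTop atTop
  first : ∀ i k, N (2 * i) ≤ k → k < N (2 * i + 1) → a k = A ∧ b k = p
  second : ∀ i k, N (2 * i + 1) ≤ k → k < N (2 * i + 2) → a k = B ∧ b k = q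

namespace AlternatingBlocks

variable {A B p q : ℝ} {N : ℕ → ℕ} {a b : ℕ → ℝ}

lemma cases (h : AlternatingBlocks A B p q N a b) (k : ℕ) :
    (a k = A ∧ b k = p) ∨ (a k = B ∧ b k = q) := by
  have hex : ∃ i, k < N (i + 1) :=
    ⟨k, lt_of_lt_of_le (Nat.lt_succ_self k) (h.mono.le_apply (x := k + 1))⟩
  classical
  have h1 := Nat.find_spec hex
  have h2 : N (Nat.find hex) ≤ k := by
    rcases Nat.eq_zero_or_pos (Nat.find hex) with h0 | h0
    · rw [h0, h.zero]; exact Nat.zero_le k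
    · have := Nat.find_min hex (Nat.sub_lt h0 one_pos)
      rw [show Nat.find hex - 1 + 1 = Nat.find hex by omega] at this
      exact not_lt.1 this
  rcases Nat.even_or_odd' (Nat.find hex) with ⟨i, hi | hi⟩
  · rw [hi] at h1 h2
    exact Or.inl (h.first i k h2 h1)
  · rw [hi] at h1 h2
    exact Or.inr (h.second i k h2 h1)

lemma le_a (h : AlternatingBlocks A B p q N a b) (k : ℕ) : B ≤ a k := by
  rcases h.cases k with ⟨h1, -⟩ | ⟨h1, -⟩ <;> rw [h1]
  exact h.lt.le

lemma min_pos (h : AlternatingBlocks A B p q N a b) : 0 < min p q := lt_min h.p_pos h.q_pos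

lemma min_le_b (h : AlternatingBlocks A B p q N a b) (k : ℕ) : min p q ≤ b k := by
  rcases h.cases k with ⟨-, h1⟩ | ⟨-, h1⟩ <;> rw [h1]
  exacts [min_le_left _ _, min_le_right _ _]

lemma b_le_half (h : AlternatingBlocks A B p q N a b) (k : ℕ) : b k ≤ 1 / 2 := by
  rcases h.cases k with ⟨-, h1⟩ | ⟨-, h1⟩ <;> rw [h1]
  exacts [h.p_le, h.q_le]

lemma b_le (h : AlternatingBlocks A B p q N a b) (k : ℕ) : b k ≤ 1 - min p q := by
  have := h.b_le_half k
  have := min_le_left p q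
  have := h.p_le
  linarith

lemma b_pos (h : AlternatingBlocks A B p q N a b) (k : ℕ) : 0 < b k :=
  h.min_pos.trans_le (h.min_le_b k)

lemma b_lt_one (h : AlternatingBlocks A B p q N a b) (k : ℕ) : b k < 1 := by
  linarith [h.b_le_half k]

lemma log_B_pos (h : AlternatingBlocks A B p q N a b) : 0 < Real.log B :=
  Real.log_pos (by linarith [h.two_lt])

lemma log_B_lt (h : AlternatingBlocks A B p q N a b) : Real.log B < Real.log A :=
  Real.log_lt_log (by linarith [h.two_lt]) h.lt

lemma log_A_pos (h : AlternatingBlocks A B p q N a b) : 0 < Real.log A :=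
  h.log_B_pos.trans h.log_B_lt

lemma eventually_le_mul (h : AlternatingBlocks A B p q N a b) {ε : ℝ} (hε : 0 < ε) :
    ∀ᶠ i in atTop, (N i : ℝ) ≤ ε * N (i + 1) := by
  filter_upwards [h.lim.eventually_ge_atTop (1 / ε)] with i hi
  rcases Nat.eq_zero_or_pos (N i) with h0 | h0
  · rw [h0]
    simp only [Nat.cast_zero]
    positivity
  · have h0' : (0 : ℝ) < N i := by exact_mod_cast h0
    rw [div_le_div_iff₀ hε h0'] at hi
    linarith

lemma eventually_sum_le (h : AlternatingBlocks A B p q N a b) {u : ℕ → ℝ} {K : ℝ}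
    (hK : ∀ k, u k ≤ K) (hu : ∀ i k, N (2 * i) ≤ k → k < N (2 * i + 1) → u k ≤ 0)
    {ε : ℝ} (hε : 0 < ε) :
    ∀ᶠ i in atTop, ∑ k ∈ Finset.range (N (2 * i + 1)), u k ≤ ε * N (2 * i + 1) := by
  have h2 : Tendsto (fun i : ℕ => 2 * i) atTop atTop :=
    tendsto_id.const_mul_atTop' two_pos
  filter_upwards [h2.eventually (h.eventually_le_mul (div_pos hε
    (lt_of_lt_of_le zero_lt_one (le_max_left 1 K))))] with i hi
  have hmax : 0 < max 1 K := lt_of_lt_of_le zero_lt_one (le_max_left 1 K)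
  have hle : N (2 * i) ≤ N (2 * i + 1) := h.mono.monotone (Nat.le_succ _)
  rw [← Finset.sum_range_add_sum_Ico _ hle]
  have h3 : ∑ k ∈ Finset.range (N (2 * i)), u k ≤ N (2 * i) * max 1 K := by
    calc _ ≤ ∑ k ∈ Finset.range (N (2 * i)), max 1 K :=
          Finset.sum_le_sum fun k _ => (hK k).trans (le_max_right _ _)
      _ = _ := by simp
  have h4 : ∑ k ∈ Finset.Ico (N (2 * i)) (N (2 * i + 1)), u k ≤ 0 :=
    Finset.sum_nonpos fun k hk => hu i k (Finset.mem_Ico.1 hk).1 (Finset.mem_Ico.1 hk).2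
  rw [div_mul_eq_mul_div, le_div_iff₀ hmax] at hi
  linarith

lemma tendsto_first_end (h : AlternatingBlocks A B p q N a b) :
    Tendsto (fun i : ℕ => N (2 * i + 1)) atTop atTop := by
  refine h.mono.tendsto_atTop.comp (tendsto_atTop_mono (fun i => ?_) tendsto_id)
  simp only [id]; omega

end AlternatingBlocks

section Legendre

variable {A p α : ℝ}

lemma betaFn_zero (p A : ℝ) : betaFn p A 0 = -Real.log 2 / Real.log A := by
  simp [betaFn, one_add_one_eq_two]

lemma betaFn_one (p A : ℝ) : betaFn p A 1 = 0 := by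
  simp [betaFn]

lemma betaFn_le (hA : 0 < Real.log A) (hp : 0 < p) (hp1 : p < 1)
    (hα1 : -Real.log (1 - p) / Real.log A ≤ α) (hα2 : α ≤ -Real.log p / Real.log A) (s : ℝ) :
    betaFn p A s ≤ s * α := by
  have h1 : 0 < p ^ s := Real.rpow_pos_of_pos hp s
  have h2 : 0 < (1 - p) ^ s := Real.rpow_pos_of_pos (by linarith) s
  rw [div_le_iff₀ hA] at hα1
  rw [le_div_iff₀ hA] at hα2
  rw [betaFn, div_le_iff₀ hA]
  rcases le_total 0 s with hs | hs
  · have := Real.log_le_log h2 (le_add_of_nonneg_left h1.le : (1 - p) ^ s ≤ p ^ s + (1 - p) ^ s)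
    rw [Real.log_rpow (by linarith)] at this
    nlinarith
  · have := Real.log_le_log h1 (le_add_of_nonneg_right h2.le : p ^ s ≤ p ^ s + (1 - p) ^ s)
    rw [Real.log_rpow hp] at this
    nlinarith

lemma betaTilde1_of_or {s : ℝ} (hs : s ≤ 0 ∨ 1 ≤ s) : betaTilde1 p A s = betaFn p A s :=
  if_pos hs

lemma betaTilde1_of_not {s : ℝ} (hs : ¬(s ≤ 0 ∨ 1 ≤ s)) :
    betaTilde1 p A s = (1 - s) * betaFn p A 0 + s * betaFn p A 1 :=
  if_neg hs

lemma bddBelow_betaTilde1 (h : ∀ s, betaFn p A s ≤ s * α) :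
    BddBelow (range fun s => s * α - betaTilde1 p A s) := by
  refine ⟨0, ?_⟩
  rintro _ ⟨s, rfl⟩
  simp only
  by_cases hs : s ≤ 0 ∨ 1 ≤ s
  · rw [betaTilde1_of_or hs]
    linarith [h s]
  · rw [betaTilde1_of_not hs]
    push Not at hs
    have h0 := h 0
    have h1 := h 1
    nlinarith [mul_le_mul_of_nonneg_left h0 (by linarith : 0 ≤ 1 - s),
      mul_le_mul_of_nonneg_left h1 hs.1.le]

lemma legendre_betaTilde1_le (h : ∀ s, betaFn p A s ≤ s * α) {s : ℝ} (hs : s ≤ 0 ∨ 1 ≤ s) :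
    legendre (betaTilde1 p A) α ≤ s * α - betaFn p A s := by
  rw [← betaTilde1_of_or hs]
  exact ciInf_le (bddBelow_betaTilde1 h) s

end Legendre

section UpperSpectrum

variable {A B p q : ℝ} {N : ℕ → ℕ} {c r : ℕ → ℝ}

lemma setOf_eq_image (μ : Measure ℝ) (α : ℝ) (hB : 2 < B) (hcB : ∀ k, B ≤ c (k + 1)) :
    {x | x ∈ moranSet c ∧ lowerLocalDim μ x = α} =
      pt (fun k => c (k + 1)) '' {ω | lowerLocalDim μ (pt (fun k => c (k + 1)) ω) = α} := by
  rw [moranSet_eq_range hB hcB]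
  ext x
  constructor
  · rintro ⟨⟨ω, rfl⟩, hx⟩
    exact ⟨ω, hx, rfl⟩
  · rintro ⟨ω, hω, rfl⟩
    exact ⟨⟨ω, rfl⟩, hω⟩

lemma log_rpow_add_le_mul (hq : 0 < q) (hq2 : q ≤ 1 / 2) {s : ℝ} (hs : 1 ≤ s) :
    Real.log (q ^ s + (1 - q) ^ s) ≤ (s - 1) * Real.log (1 - q) := by
  have hq1 : 0 < 1 - q := by linarith
  rw [← Real.log_rpow hq1]
  apply Real.log_le_log (by positivity)
  have e1 : q ^ s = q * q ^ (s - 1) := by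
    rw [← Real.rpow_one_add' hq.le (by linarith)]; congr 1; ring
  have e2 : (1 - q) ^ s = (1 - q) * (1 - q) ^ (s - 1) := by
    rw [← Real.rpow_one_add' hq1.le (by linarith)]; congr 1; ring
  have h3 : q ^ (s - 1) ≤ (1 - q) ^ (s - 1) :=
    Real.rpow_le_rpow hq.le (by linarith) (by linarith)
  rw [e1, e2]
  nlinarith

lemma mul_le_log_rpow_add (hp : 0 < p) (hp2 : p ≤ 1 / 2) {s : ℝ} (hs : 1 ≤ s) :
    (s - 1) * Real.log p ≤ Real.log (p ^ s + (1 - p) ^ s) := by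
  have hp1 : 0 < 1 - p := by linarith
  rw [← Real.log_rpow hp]
  apply Real.log_le_log (by positivity)
  have e1 : p ^ s = p * p ^ (s - 1) := by
    rw [← Real.rpow_one_add' hp.le (by linarith)]; congr 1; ring
  have e2 : (1 - p) ^ s = (1 - p) * (1 - p) ^ (s - 1) := by
    rw [← Real.rpow_one_add' hp1.le (by linarith)]; congr 1; ring
  have h3 : p ^ (s - 1) ≤ (1 - p) ^ (s - 1) :=
    Real.rpow_le_rpow hp.le (by linarith) (by linarith)
  rw [e1, e2]
  nlinarith

lemma dimH_le_sub_betaFn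
    (h : AlternatingBlocks A B p q N (fun k => c (k + 1)) (fun k => r (k + 1)))
    (hpq : -Real.log p / Real.log A < -Real.log (1 - q) / Real.log B)
    {μ : Measure ℝ} [IsProbabilityMeasure μ]
    (hμ : ∀ w : List Bool, μ (moranI c w) = ENNReal.ofReal (cylMass r w 1 1))
    {α : ℝ} (hα : ∀ s, betaFn p A s ≤ s * α) {s : ℝ} (hs : s ≤ 0 ∨ 1 ≤ s) :
    dimH {x | x ∈ moranSet c ∧ lowerLocalDim μ x = α} ≤
      ENNReal.ofReal (s * α - betaFn p A s) := by
  have hdim := fun ω => lowerLocalDim_eq_iff h.two_lt h.le_a hμ h.min_pos h.min_le_b h.b_le ω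
    (α := α)
  rw [setOf_eq_image μ α h.two_lt h.le_a]
  set a : ℕ → ℝ := fun k => c (k + 1)
  set b : ℕ → ℝ := fun k => r (k + 1)
  set v := s * α - betaFn p A s with hv
  have hv0 : 0 ≤ v := by have := hα s; linarith
  have hlA := h.log_A_pos
  have hlB := h.log_B_pos
  have hlim : Tendsto (fun D : ℝ => ENNReal.ofReal D) (𝓝[>] v) (𝓝 (ENNReal.ofReal v)) :=
    (ENNReal.continuous_ofReal.tendsto v).mono_left nhdsWithin_le_nhds
  refine ge_of_tendsto hlim ?_
  filter_upwards [self_mem_nhdsWithin] with D hD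
  have hD : v < D := hD
  set ε := (D - v) / (4 * (|s| + 1)) with hε
  have hs0 : 0 ≤ |s| := abs_nonneg s
  have hεpos : 0 < ε := div_pos (by linarith) (by linarith)
  have hεs : |s| * ε ≤ (D - v) / 4 := by
    rw [hε, mul_div_assoc', div_le_div_iff₀ (by linarith) (by norm_num)]
    nlinarith
  set z : ℕ → ℝ := fun k => b k ^ s + (1 - b k) ^ s with hz
  have hzpos : ∀ k, 0 < z k := fun k => by
    have := h.b_pos k
    have : 0 < 1 - b k := by linarith [h.b_lt_one k]
    positivity
  set I : Set ℕ := {n | ∑ k ∈ Finset.range n, (Real.log (z k) + betaFn p A s * Real.log (a k)) ≤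
    (D - v) / 4 * logLen a n} with hI
  have hzA : Real.log (p ^ s + (1 - p) ^ s) + betaFn p A s * Real.log A = 0 := by
    rw [betaFn]
    field_simp
    ring
  have hcover : ∀ θ, s * θ ≤ s * α + (D - v) / 4 → ∀ n ∈ I,
      Real.exp (-((D - s * θ) * logLen a n)) *
      ∏ k ∈ Finset.range n, (b k ^ s + (1 - b k) ^ s) ≤
        Real.exp (-((D - v) / 2 * Real.log B * n)) := by
    intro θ hθ n hn
    have e1 : ∏ k ∈ Finset.range n, (b k ^ s + (1 - b k) ^ s) =
        Real.exp (∑ k ∈ Finset.range n, Real.log (z k)) := by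
      rw [Real.exp_sum]
      exact Finset.prod_congr rfl fun k _ => (Real.exp_log (hzpos k)).symm
    rw [e1, ← Real.exp_add]
    apply Real.exp_le_exp.2
    have h1 : ∑ k ∈ Finset.range n, (Real.log (z k) + betaFn p A s * Real.log (a k)) ≤
      (D - v) / 4 * logLen a n := hn
    rw [Finset.sum_add_distrib, ← Finset.mul_sum] at h1
    change ∑ k ∈ Finset.range n, Real.log (z k) + betaFn p A s * logLen a n ≤
      (D - v) / 4 * logLen a n at h1
    have h2 : n * Real.log B ≤ logLen a n := le_logLen h.two_lt h.le_a n
    have h3 : 0 ≤ logLen a n := le_trans (by positivity) h2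
    have h4 := mul_le_mul_of_nonneg_right hθ h3
    have h5 := mul_le_mul_of_nonneg_left h2 (by linarith : 0 ≤ (D - v) / 2)
    have h6 : v * logLen a n = s * α * logLen a n - betaFn p A s * logLen a n := by
      rw [hv]; ring
    linarith
  have hη : 0 < (D - v) / 2 * Real.log B := mul_pos (by linarith) hlB
  have hD0 : 0 ≤ D := hv0.trans hD.le
  rcases hs with hs | hs
  · refine (dimH_mono (image_mono ?_)).trans (dimH_le_of_frequently h.two_lt h.le_a h.b_pos
      h.b_lt_one hD0 hη I (hcover (α - ε) ?_))
    · intro ω hω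
      have h1 := ((hdim ω).1 hω ε hεpos).1
      have hIfreq : ∃ᶠ n in atTop, n ∈ I := by
        refine h.tendsto_first_end.frequently (Eventually.frequently ?_)
        have hle := h.eventually_sum_le
          (u := fun k => Real.log (z k) + betaFn p A s * Real.log (a k))
          (K := max 0 (Real.log (q ^ s + (1 - q) ^ s) + betaFn p A s * Real.log B)) ?_ ?_
          (ε := (D - v) / 4 * Real.log B) (mul_pos (by linarith) hlB)
        · filter_upwards [hle] with i hi
          refine hi.trans ?_
          have := le_logLen h.two_lt h.le_a (N (2 * i + 1))
          nlinarith
        · intro k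
          rcases h.cases k with ⟨h2, h3⟩ | ⟨h2, h3⟩ <;> simp only [hz, h2, h3]
          · rw [hzA]; exact le_max_left _ _
          · exact le_max_right _ _
        · intro i k hk1 hk2
          obtain ⟨h2, h3⟩ := h.first i k hk1 hk2
          simp only [hz, h2, h3]
          exact hzA.le
      refine (hIfreq.and_eventually h1).mono fun n hn => ⟨hn.1, ?_⟩
      rw [mul_assoc]
      exact mul_le_mul_of_nonpos_left hn.2 hs
    · rw [abs_of_nonpos hs] at hεs
      linarith
  · refine (dimH_mono (image_mono ?_)).trans (dimH_le_of_frequently h.two_lt h.le_a h.b_pos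
      h.b_lt_one hD0 hη I (hcover (α + ε) ?_))
    · intro ω hω
      refine ((hdim ω).1 hω ε hεpos).2.mono fun n hn => ⟨?_, ?_⟩
      · have h3 : 0 ≤ logLen a n := le_trans (by positivity) (le_logLen h.two_lt h.le_a n)
        refine le_trans (Finset.sum_nonpos fun k _ => ?_) (mul_nonneg (by linarith) h3)
        rcases h.cases k with ⟨h2, h3⟩ | ⟨h2, h3⟩ <;> simp only [hz, h2, h3]
        · exact hzA.le
        · have h4 := log_rpow_add_le_mul h.q_pos h.q_le hs
          have h5 := mul_le_log_rpow_add h.p_pos h.p_le hs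
          have h6 : betaFn p A s ≤ (s - 1) * (-Real.log p / Real.log A) := by
            rw [betaFn, mul_div_assoc', div_le_div_iff_of_pos_right hlA]
            linarith
          have h7 : betaFn p A s ≤ (s - 1) * (-Real.log (1 - q) / Real.log B) :=
            h6.trans (mul_le_mul_of_nonneg_left hpq.le (by linarith))
          have h8 : betaFn p A s * Real.log B ≤ (s - 1) * -Real.log (1 - q) := by
            rw [mul_div_assoc', le_div_iff₀ hlB] at h7
            exact h7
          linarith
      · rw [mul_assoc]
        exact mul_le_mul_of_nonneg_left hn (by linarith)
    · rw [abs_of_nonneg (by linarith)] at hεs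
      linarith

end UpperSpectrum

section CrossEntropy

lemma crossEnt_eq (x y : ℝ) :
    crossEnt x y = -Real.log (1 - y) + x * (Real.log (1 - y) - Real.log y) := by
  rw [crossEnt]; ring

lemma log_sub_log_nonneg {y : ℝ} (hy : 0 < y) (hy2 : y ≤ 1 / 2) :
    0 ≤ Real.log (1 - y) - Real.log y :=
  sub_nonneg.2 (Real.log_le_log hy (by linarith))

lemma crossEnt_mono {x x' y : ℝ} (hy : 0 < y) (hy2 : y ≤ 1 / 2) (hx : x ≤ x') :
    crossEnt x y ≤ crossEnt x' y := by
  rw [crossEnt_eq, crossEnt_eq]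
  linarith [mul_le_mul_of_nonneg_right hx (log_sub_log_nonneg hy hy2)]

lemma neg_log_le_crossEnt {x y : ℝ} (hy : 0 < y) (hy2 : y ≤ 1 / 2) (hx : 0 ≤ x) :
    -Real.log (1 - y) ≤ crossEnt x y := by
  rw [crossEnt_eq]
  linarith [mul_nonneg hx (log_sub_log_nonneg hy hy2)]

lemma crossEnt_nonneg {x y : ℝ} (hx : 0 ≤ x) (hx1 : x ≤ 1) (hy : 0 < y) (hy1 : y < 1) :
    0 ≤ crossEnt x y :=
  add_nonneg (mul_nonneg hx (neg_nonneg.2 (Real.log_nonpos hy.le hy1.le)))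
    (mul_nonneg (by linarith) (neg_nonneg.2 (Real.log_nonpos (by linarith) (by linarith))))

lemma crossEnt_self_le (x : ℝ) : crossEnt x x ≤ Real.log 2 := by
  have h : crossEnt x x = Real.binEntropy x := by
    simp only [crossEnt, Real.binEntropy, Real.log_inv]
  rw [h]
  exact Real.binEntropy_le_log_two

lemma crossEnt_half : crossEnt (1 / 2) (1 / 2) = Real.log 2 := by
  rw [crossEnt, show (1 : ℝ) - 1 / 2 = 2⁻¹ by norm_num, show (1 : ℝ) / 2 = 2⁻¹ by norm_num,
    Real.log_inv]
  ring

end CrossEntropy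

section LowerSpectrum

variable {A B p q : ℝ} {N : ℕ → ℕ} {c r : ℕ → ℝ}

/-- Lower bound for a level set by a product measure with weights `t`, given control of the
entropies and cross entropies of `t`. -/
lemma ofReal_le_dimH_of_sums
    (h : AlternatingBlocks A B p q N (fun k => c (k + 1)) (fun k => r (k + 1)))
    {μ : Measure ℝ} [IsProbabilityMeasure μ]
    (hμ : ∀ w : List Bool, μ (moranI c w) = ENNReal.ofReal (cylMass r w 1 1))
    {t : ℕ → ℝ} {δ : ℝ} (hδ : 0 < δ) (ht0 : ∀ k, δ ≤ t k) (ht1 : ∀ k, t k ≤ 1 - δ) {α d C : ℝ}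
    (hd : ∀ n, -C ≤ ∑ k ∈ Finset.range n, (crossEnt (t k) (t k) - d * Real.log (c (k + 1))))
    (hα : ∀ n, -C ≤ ∑ k ∈ Finset.range n, (crossEnt (t k) (r (k + 1)) - α * Real.log (c (k + 1))))
    (hα' : ∀ ε : ℝ, 0 < ε → ∃ᶠ n : ℕ in atTop,
      ∑ k ∈ Finset.range n, (crossEnt (t k) (r (k + 1)) - α * Real.log (c (k + 1))) ≤ ε * n) :
    ENNReal.ofReal d ≤ dimH {x | x ∈ moranSet c ∧ lowerLocalDim μ x = α} := by
  have hdim := fun ω => lowerLocalDim_eq_iff h.two_lt h.le_a hμ h.min_pos h.min_le_b h.b_le ω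
    (α := α)
  rw [setOf_eq_image μ α h.two_lt h.le_a]
  have hLB : ∀ n : ℕ, n * Real.log B ≤ logLen (fun k => c (k + 1)) n := le_logLen h.two_lt h.le_a
  set a : ℕ → ℝ := fun k => c (k + 1) with ha
  set b : ℕ → ℝ := fun k => r (k + 1) with hb
  have hlB := h.log_B_pos
  have ht0' : ∀ k, 0 < t k := fun k => hδ.trans_le (ht0 k)
  have ht1' : ∀ k, t k < 1 := fun k => by linarith [ht1 k]
  have hsplit : ∀ (u : ℕ → ℝ) (θ : ℝ) (n : ℕ),
      ∑ k ∈ Finset.range n, (u k - θ * Real.log (c (k + 1))) =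
        ∑ k ∈ Finset.range n, u k - θ * logLen a n := by
    intro u θ n
    rw [Finset.sum_sub_distrib, ← Finset.mul_sum, logLen]
  simp only [hsplit] at hd hα hα'
  have hC : ∀ ε : ℝ, 0 < ε → ∀ᶠ n : ℕ in atTop, C ≤ ε * n := fun ε hε =>
    (tendsto_natCast_atTop_atTop.const_mul_atTop hε).eventually_ge_atTop C
  have hL : ∀ ε : ℝ, 0 < ε → ∀ n : ℕ, ε * Real.log B / 2 * n + ε * Real.log B / 2 * n ≤
      ε * logLen a n := fun ε hε n => by
    have := mul_le_mul_of_nonneg_left (hLB n) hε.le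
    linarith
  refine le_dimH_of_ae h.two_lt h.le_a ht0' ht1' ?_ ?_
  · have hae : ∀ᵐ ω ∂Measure.infinitePi (fun k => coin (t k)), ∀ m : ℕ, ∀ᶠ n : ℕ in atTop,
        |info b ω n - ∑ k ∈ Finset.range n, crossEnt (t k) (b k)| < 1 / ((m : ℝ) + 1) * n :=
      ae_all_iff.2 fun m => ae_info_sub_lt ht0' ht1' h.min_pos h.min_le_b h.b_le (by positivity)
    filter_upwards [hae] with ω hω
    refine mem_image_of_mem _ ((hdim ω).2 fun ε hε => ?_)
    have hη : 0 < ε * Real.log B / 2 := by positivity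
    obtain ⟨m, hm⟩ := exists_nat_one_div_lt hη
    have hω' : ∀ᶠ n : ℕ in atTop,
        |info b ω n - ∑ k ∈ Finset.range n, crossEnt (t k) (b k)| < ε * Real.log B / 2 * n :=
      (hω m).mono fun n hn =>
        hn.trans_le (mul_le_mul_of_nonneg_right hm.le (Nat.cast_nonneg n))
    constructor
    · filter_upwards [hω', hC _ hη] with n hn1 hn2
      have h1 := hα n
      have h2 := (abs_lt.1 hn1).1
      have h3 := hL ε hε n
      linarith
    · refine ((hα' _ hη).and_eventually hω').mono fun n hn => ?_
      have h1 := hn.1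
      have h2 := (abs_lt.1 hn.2).2
      have h3 := hL ε hε n
      linarith
  · intro ε hε
    have hη : 0 < ε * Real.log B / 2 := by positivity
    filter_upwards [ae_info_sub_lt ht0' ht1' hδ ht0 ht1 hη] with ω hω
    filter_upwards [hω, hC _ hη] with n hn1 hn2
    have h1 := hd n
    have h2 := (abs_lt.1 hn1).1
    have h3 := hL ε hε n
    linarith

lemma mul_log_le (hlB : 0 < Real.log B) {α : ℝ}
    (hpq : -Real.log p / Real.log A < -Real.log (1 - q) / Real.log B)
    (hα2 : α ≤ -Real.log p / Real.log A) : α * Real.log B ≤ -Real.log (1 - q) :=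
  (le_div_iff₀ hlB).1 (hα2.trans hpq.le)

/-- Lower bound using the weight `τ` on the `A`-blocks and the uniform weight elsewhere. -/
lemma ofReal_le_dimH_of_block_weight
    (h : AlternatingBlocks A B p q N (fun k => c (k + 1)) (fun k => r (k + 1)))
    (hpq : -Real.log p / Real.log A < -Real.log (1 - q) / Real.log B)
    {μ : Measure ℝ} [IsProbabilityMeasure μ]
    (hμ : ∀ w : List Bool, μ (moranI c w) = ENNReal.ofReal (cylMass r w 1 1))
    {α d τ : ℝ} (hα2 : α ≤ -Real.log p / Real.log A) (hτ0 : 0 < τ) (hτ1 : τ < 1)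
    (hατ : α * Real.log A = crossEnt τ p) (hdτ : d * Real.log A = crossEnt τ τ) :
    ENNReal.ofReal d ≤ dimH {x | x ∈ moranSet c ∧ lowerLocalDim μ x = α} := by
  have hlA := h.log_A_pos
  have hlB := h.log_B_pos
  have hAB := h.log_B_lt
  classical
  set t : ℕ → ℝ := fun k => if c (k + 1) = A then τ else 1 / 2 with ht
  have hstep : ∀ k, (c (k + 1) = A ∧ r (k + 1) = p ∧ t k = τ) ∨
      (c (k + 1) = B ∧ r (k + 1) = q ∧ t k = 1 / 2) := by
    intro k
    rcases h.cases k with ⟨h1, h2⟩ | ⟨h1, h2⟩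
    · exact Or.inl ⟨h1, h2, if_pos h1⟩
    · refine Or.inr ⟨h1, h2, if_neg ?_⟩
      change c (k + 1) = B at h1
      rw [h1]
      exact h.lt.ne
  have hd0 : 0 ≤ d := by
    have := crossEnt_nonneg hτ0.le hτ1.le hτ0 hτ1
    rw [← hdτ] at this
    exact nonneg_of_mul_nonneg_left this hlA
  have hd2 : d * Real.log B ≤ Real.log 2 := by
    have := crossEnt_self_le τ
    have := mul_le_mul_of_nonneg_left hAB.le hd0
    linarith
  have hαB := mul_log_le hlB hpq hα2
  have hhalf := neg_log_le_crossEnt (x := 1 / 2) h.q_pos h.q_le (by norm_num)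
  refine ofReal_le_dimH_of_sums h hμ (t := t) (δ := min (min τ (1 - τ)) (1 / 2)) (C := 0)
    (lt_min (lt_min hτ0 (by linarith)) (by norm_num)) ?_ ?_ ?_ ?_ ?_
  · intro k
    rcases hstep k with ⟨-, -, h3⟩ | ⟨-, -, h3⟩ <;> rw [h3]
    exacts [(min_le_left _ _).trans (min_le_left _ _), min_le_right _ _]
  · intro k
    rcases hstep k with ⟨-, -, h3⟩ | ⟨-, -, h3⟩ <;> rw [h3]
    · linarith [(min_le_left (min τ (1 - τ)) (1 / 2)).trans (min_le_right _ _)]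
    · linarith [min_le_right (min τ (1 - τ)) (1 / 2)]
  · intro n
    rw [neg_zero]
    refine Finset.sum_nonneg fun k _ => ?_
    rcases hstep k with ⟨h1, -, h3⟩ | ⟨h1, -, h3⟩ <;> rw [h1, h3]
    · linarith
    · rw [crossEnt_half]; linarith
  · intro n
    rw [neg_zero]
    refine Finset.sum_nonneg fun k _ => ?_
    rcases hstep k with ⟨h1, h2, h3⟩ | ⟨h1, h2, h3⟩ <;> rw [h1, h2, h3] <;> linarith
  · intro ε hε
    refine h.tendsto_first_end.frequently (Eventually.frequently ?_)
    refine h.eventually_sum_le (K := max 0 (crossEnt (1 / 2) q - α * Real.log B)) ?_ ?_ hε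
    · intro k
      rcases hstep k with ⟨h1, h2, h3⟩ | ⟨h1, h2, h3⟩ <;> rw [h1, h2, h3]
      · rw [hατ, sub_self]; exact le_max_left _ _
      · exact le_max_right _ _
    · intro i k hk1 hk2
      obtain ⟨h1, h2⟩ := h.first i k hk1 hk2
      change c (k + 1) = A at h1
      change r (k + 1) = p at h2
      have h3 : t k = τ := if_pos h1
      rw [h1, h2, h3, hατ, sub_self]

lemma neg_le_sum_of_sum_pos {f g : ℕ → ℝ} {C : ℝ} (hC : 0 ≤ C) (hfg : ∀ k, g k ≤ f k)
    (hf : ∀ k, 0 ≤ f k ∨ (0 < ∑ j ∈ Finset.range k, g j ∧ -C ≤ g k)) (n : ℕ) :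
    -C ≤ ∑ k ∈ Finset.range n, f k := by
  induction n with
  | zero => simpa using hC
  | succ n ih =>
    rcases hf n with h1 | ⟨h1, h2⟩
    · rw [Finset.sum_range_succ]; linarith
    · have h3 : ∑ k ∈ Finset.range (n + 1), g k ≤ ∑ k ∈ Finset.range (n + 1), f k :=
        Finset.sum_le_sum fun k _ => hfg k
      rw [Finset.sum_range_succ] at h3
      linarith

/-- Lower bound using the weights of `μ`, except that the uniform weight is used on the `A`-blocks
as long as the accumulated entropy of `μ` has not exceeded its target. -/
lemma ofReal_le_dimH_of_adaptive_weight
    (h : AlternatingBlocks A B p q N (fun k => c (k + 1)) (fun k => r (k + 1)))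
    (hpq : -Real.log p / Real.log A < -Real.log (1 - q) / Real.log B)
    {μ : Measure ℝ} [IsProbabilityMeasure μ]
    (hμ : ∀ w : List Bool, μ (moranI c w) = ENNReal.ofReal (cylMass r w 1 1))
    {α d : ℝ} (hα2 : α ≤ -Real.log p / Real.log A)
    (hα3 : crossEnt p p < α * Real.log A) (hα4 : α * Real.log A ≤ crossEnt (1 / 2) p)
    (hdα : d ≤ α) (hd2 : d * Real.log A ≤ Real.log 2) :
    ENNReal.ofReal d ≤ dimH {x | x ∈ moranSet c ∧ lowerLocalDim μ x = α} := by
  have hlA := h.log_A_pos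
  have hlB := h.log_B_pos
  have hp0 := h.p_pos
  have hp2 := h.p_le
  have hpp := crossEnt_nonneg hp0.le (by linarith) hp0 (by linarith)
  have hαB := mul_log_le hlB hpq hα2
  have hqq := neg_log_le_crossEnt h.q_pos h.q_le h.q_pos.le
  have hdA : d * Real.log A ≤ α * Real.log A := mul_le_mul_of_nonneg_right hdα hlA.le
  have hdB : d * Real.log B ≤ α * Real.log B := mul_le_mul_of_nonneg_right hdα hlB.le
  have hhalf := crossEnt_mono hp0 hp2 hp2
  have hpp2 := crossEnt_self_le p
  classical
  set g : ℕ → ℝ := fun k => crossEnt (r (k + 1)) (r (k + 1)) - α * Real.log (c (k + 1)) with hg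
  set M : ℕ → ℝ := fun n => ∑ k ∈ Finset.range n, g k with hM
  set t : ℕ → ℝ := fun k => if c (k + 1) = A ∧ M k ≤ 0 then 1 / 2 else r (k + 1) with ht
  have hstep : ∀ k, (c (k + 1) = A ∧ r (k + 1) = p ∧ t k = 1 / 2 ∧ M k ≤ 0) ∨
      (c (k + 1) = A ∧ r (k + 1) = p ∧ t k = p ∧ 0 < M k) ∨
      (c (k + 1) = B ∧ r (k + 1) = q ∧ t k = q) := by
    intro k
    rcases h.cases k with ⟨h1, h2⟩ | ⟨h1, h2⟩
    · change c (k + 1) = A at h1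
      change r (k + 1) = p at h2
      rcases le_or_gt (M k) 0 with h3 | h3
      · exact Or.inl ⟨h1, h2, if_pos ⟨h1, h3⟩, h3⟩
      · refine Or.inr (Or.inl ⟨h1, h2, ?_, h3⟩)
        rw [ht]
        simp only [not_le.2 h3, and_false, if_false, h2]
    · change c (k + 1) = B at h1
      change r (k + 1) = q at h2
      refine Or.inr (Or.inr ⟨h1, h2, ?_⟩)
      rw [ht]
      simp only [h1, h.lt.ne, false_and, if_false, h2]
  have htr : ∀ k, t k = 1 / 2 ∨ t k = r (k + 1) := fun k => by
    rcases hstep k with ⟨-, -, h3, -⟩ | ⟨-, h2, h3, -⟩ | ⟨-, h2, h3⟩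
    · exact Or.inl h3
    · exact Or.inr (h3.trans h2.symm)
    · exact Or.inr (h3.trans h2.symm)
  refine ofReal_le_dimH_of_sums h hμ (t := t) (C := α * Real.log A) h.min_pos ?_ ?_ ?_ ?_ ?_
  · intro k
    rcases htr k with h1 | h1 <;> rw [h1]
    exacts [(min_le_left p q).trans hp2, h.min_le_b k]
  · intro k
    rcases htr k with h1 | h1 <;> rw [h1]
    exacts [by linarith [min_le_left p q], h.b_le k]
  · refine neg_le_sum_of_sum_pos (g := g) (by linarith) ?_ ?_
    · intro k
      simp only [hg]
      rcases hstep k with ⟨h1, h2, h3, -⟩ | ⟨h1, h2, h3, -⟩ | ⟨h1, h2, h3⟩ <;> rw [h1, h2, h3]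
      · rw [crossEnt_half]; linarith
      · linarith
      · linarith
    · intro k
      rcases hstep k with ⟨h1, -, h3, -⟩ | ⟨h1, h2, -, h4⟩ | ⟨h1, h2, h3⟩
      · left; rw [h1, h3, crossEnt_half]; linarith
      · right; exact ⟨h4, by simp only [hg]; rw [h1, h2]; linarith⟩
      · left; rw [h1, h3]; linarith
  · refine neg_le_sum_of_sum_pos (g := g) (by linarith) ?_ ?_
    · intro k
      simp only [hg]
      rcases hstep k with ⟨h1, h2, h3, -⟩ | ⟨h1, h2, h3, -⟩ | ⟨h1, h2, h3⟩ <;> rw [h1, h2, h3]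
      linarith
    · intro k
      rcases hstep k with ⟨h1, h2, h3, -⟩ | ⟨h1, h2, -, h4⟩ | ⟨h1, h2, h3⟩
      · left; rw [h1, h2, h3]; linarith
      · right; exact ⟨h4, by simp only [hg]; rw [h1, h2]; linarith⟩
      · left; rw [h1, h2, h3]; linarith
  · intro ε hε
    set G := max 1 (crossEnt (1 / 2) p - crossEnt p p) with hG
    have hG0 : 0 < G := lt_of_lt_of_le zero_lt_one (le_max_left _ _)
    set e : ℕ → ℝ := fun k => crossEnt (t k) (r (k + 1)) - crossEnt (r (k + 1)) (r (k + 1)) with he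
    have heG : ∀ k, e k ≤ G := by
      intro k
      simp only [he]
      rcases hstep k with ⟨h1, h2, h3, -⟩ | ⟨h1, h2, h3, -⟩ | ⟨h1, h2, h3⟩ <;> rw [h2, h3]
      · exact le_max_right _ _
      · rw [sub_self]; exact hG0.le
      · rw [sub_self]; exact hG0.le
    have hodd : Tendsto (fun i : ℕ => 2 * i + 1) atTop atTop :=
      tendsto_atTop_mono (fun i => by simp only [id]; omega) tendsto_id
    have hev1 := hodd.eventually (h.eventually_le_mul (div_pos hε hG0))
    have hev2 := h.eventually_sum_le (u := fun k => g k + (α * Real.log A - crossEnt p p))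
      (K := max 0 (crossEnt q q - α * Real.log B + (α * Real.log A - crossEnt p p)))
      (ε := α * Real.log A - crossEnt p p) (fun k => ?_) (fun i k hk1 hk2 => ?_) (by linarith)
    · rw [frequently_atTop]
      intro m
      obtain ⟨i, hi1, hi2, hi3⟩ := (hev1.and (((tendsto_add_atTop_nat 1).eventually hev2).and
        (eventually_ge_atTop m))).exists
      have hex : ∃ n, N (2 * i + 2) ≤ n ∧ M n ≤ 0 := by
        refine ⟨N (2 * (i + 1) + 1), h.mono.monotone (by omega), ?_⟩
        rw [Finset.sum_add_distrib] at hi2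
        simp only [Finset.sum_const, Finset.card_range, nsmul_eq_mul] at hi2
        change M (N (2 * (i + 1) + 1)) + _ ≤ _ at hi2
        linarith
      obtain ⟨hn1, hn2⟩ := Nat.find_spec hex
      have hn3 : ∀ k < Nat.find hex, N (2 * i + 2) ≤ k → 0 < M k := fun k hk hk' =>
        not_le.1 fun hle => Nat.find_min hex hk ⟨hk', hle⟩
      set n := Nat.find hex
      refine ⟨n, hi3.trans (le_trans ?_ hn1), ?_⟩
      · exact le_trans (by omega) (h.mono.le_apply (x := 2 * i + 2))
      have hN12 : N (2 * i + 1) ≤ n := (h.mono.monotone (by omega)).trans hn1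
      have hsum : ∑ k ∈ Finset.range n, (crossEnt (t k) (r (k + 1)) - α * Real.log (c (k + 1))) =
          M n + ∑ k ∈ Finset.range n, e k := by
        simp only [hM, hg, he]
        rw [← Finset.sum_add_distrib]
        exact Finset.sum_congr rfl fun k _ => by ring
      have hz : ∑ k ∈ Finset.Ico (N (2 * i + 1)) n, e k ≤ 0 := by
        refine Finset.sum_nonpos fun k hk => ?_
        obtain ⟨hk1, hk2⟩ := Finset.mem_Ico.1 hk
        simp only [he]
        rcases hstep k with ⟨h1, -, -, h4⟩ | ⟨-, h2, h3, -⟩ | ⟨-, h2, h3⟩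
        · exfalso
          rcases lt_or_ge k (N (2 * i + 2)) with h5 | h5
          · have h6 := (h.second i k hk1 h5).1
            change c (k + 1) = B at h6
            exact h.lt.ne (h6.symm.trans h1)
          · exact absurd h4 (not_le.2 (hn3 k hk2 h5))
        · rw [h2, h3, sub_self]
        · rw [h2, h3, sub_self]
      have hfirst : ∑ k ∈ Finset.range (N (2 * i + 1)), e k ≤ N (2 * i + 1) * G := by
        calc _ ≤ ∑ k ∈ Finset.range (N (2 * i + 1)), G := Finset.sum_le_sum fun k _ => heG k
          _ = _ := by simp
      rw [hsum, ← Finset.sum_range_add_sum_Ico _ hN12]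
      rw [div_mul_eq_mul_div, le_div_iff₀ hG0] at hi1
      have hn1' : (N (2 * i + 1 + 1) : ℝ) ≤ n := by exact_mod_cast hn1
      have := mul_le_mul_of_nonneg_left hn1' hε.le
      linarith
    · simp only [hg]
      rcases hstep k with ⟨h1, h2, -⟩ | ⟨h1, h2, -⟩ | ⟨h1, h2, -⟩ <;> rw [h1, h2]
      · exact le_max_of_le_left (by linarith)
      · exact le_max_of_le_left (by linarith)
      · exact le_max_right _ _
    · obtain ⟨h1, h2⟩ := h.first i k hk1 hk2
      change c (k + 1) = A at h1
      change r (k + 1) = p at h2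
      simp only [hg]
      rw [h1, h2]
      linarith

end LowerSpectrum

section LegendreLower

variable {A p α τ : ℝ}

lemma exists_mul_sub_betaFn_eq (hA : 0 < Real.log A) (hp : 0 < p) (hp2 : p < 1 / 2)
    (hτ0 : 0 < τ) (hτ1 : τ < 1) (hατ : α * Real.log A = crossEnt τ p) :
    ∃ s, s * α - betaFn p A s = crossEnt τ τ / Real.log A ∧ (1 / 2 ≤ τ → s ≤ 0) ∧
      (τ ≤ p → 1 ≤ s) := by
  have hp1 : 0 < 1 - p := by linarith
  have hτ1' : 0 < 1 - τ := by linarith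
  set κ := Real.log p - Real.log (1 - p) with hκ
  have hκ0 : κ < 0 := sub_neg.2 (Real.log_lt_log hp (by linarith))
  set s := (Real.log τ - Real.log (1 - τ)) / κ with hs
  have hsκ : s * κ = Real.log τ - Real.log (1 - τ) := div_mul_cancel₀ _ hκ0.ne
  refine ⟨s, ?_, fun h => ?_, fun h => ?_⟩
  · have h1 : p ^ s * (1 - τ) = τ * (1 - p) ^ s := by
      rw [Real.rpow_def_of_pos hp, Real.rpow_def_of_pos hp1]
      nth_rewrite 1 [← Real.exp_log hτ1']
      nth_rewrite 2 [← Real.exp_log hτ0]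
      rw [← Real.exp_add, ← Real.exp_add]
      congr 1
      rw [hκ] at hsκ
      linarith
    have hZ : 0 < p ^ s + (1 - p) ^ s := by positivity
    have h2 : (p ^ s + (1 - p) ^ s) * (1 - τ) = (1 - p) ^ s := by
      rw [add_mul, h1]; ring
    have h3 := Real.log_mul hZ.ne' hτ1'.ne'
    rw [h2, Real.log_rpow hp1, ← sub_eq_iff_eq_add] at h3
    rw [betaFn, ← h3, eq_div_iff hA.ne', sub_mul, div_mul_cancel₀ _ hA.ne', mul_assoc, hατ,
      crossEnt_eq, crossEnt_eq]
    linear_combination -τ * hsκ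
  · have : Real.log (1 - τ) ≤ Real.log τ := Real.log_le_log hτ1' (by linarith)
    exact div_nonpos_of_nonneg_of_nonpos (by linarith) hκ0.le
  · have h1 : Real.log τ ≤ Real.log p := Real.log_le_log hτ0 h
    have h2 : Real.log (1 - p) ≤ Real.log (1 - τ) := Real.log_le_log hp1 (by linarith)
    rw [hs, one_le_div_of_neg hκ0]
    linarith

lemma legendre_betaTilde1_nonpos_of_le_rpow (hA : 0 < Real.log A) (hp : 0 < p) (hp2 : p < 1 / 2)
    (h : ∀ u : ℝ, 1 ≤ u → legendre (betaTilde1 p A) α ≤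
      Real.log (1 + (p / (1 - p)) ^ u) / Real.log A) :
    legendre (betaTilde1 p A) α ≤ 0 := by
  have hp1 : 0 < 1 - p := by linarith
  have hx0 : 0 < p / (1 - p) := by positivity
  have hx1 : p / (1 - p) < 1 := by rw [div_lt_one hp1]; linarith
  have hlim := (tendsto_rpow_atTop_of_base_lt_one (p / (1 - p)) (by linarith) hx1).div_const
    (Real.log A)
  rw [zero_div] at hlim
  refine ge_of_tendsto hlim ?_
  filter_upwards [eventually_ge_atTop 1] with u hu
  refine (h u hu).trans (div_le_div_of_nonneg_right ?_ hA.le)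
  have := Real.log_le_sub_one_of_pos (by positivity : 0 < 1 + (p / (1 - p)) ^ u)
  linarith

lemma legendre_betaTilde1_nonpos_left (hA : 0 < Real.log A) (hp : 0 < p) (hp2 : p < 1 / 2)
    (hβ : ∀ s, betaFn p A s ≤ s * α) (hα : α * Real.log A = -Real.log (1 - p)) :
    legendre (betaTilde1 p A) α ≤ 0 := by
  have hp1 : 0 < 1 - p := by linarith
  refine legendre_betaTilde1_nonpos_of_le_rpow hA hp hp2 fun u hu => ?_
  refine (legendre_betaTilde1_le hβ (Or.inr hu)).trans_eq ?_
  have h1 : 1 + (p / (1 - p)) ^ u = (p ^ u + (1 - p) ^ u) / (1 - p) ^ u := by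
    rw [Real.div_rpow hp.le hp1.le]
    field_simp
    ring
  rw [h1, Real.log_div (by positivity) (by positivity), Real.log_rpow hp1, betaFn,
    eq_div_iff hA.ne', sub_mul, div_mul_cancel₀ _ hA.ne', mul_assoc, hα]
  ring

lemma legendre_betaTilde1_nonpos_right (hA : 0 < Real.log A) (hp : 0 < p) (hp2 : p < 1 / 2)
    (hβ : ∀ s, betaFn p A s ≤ s * α) (hα : α * Real.log A = -Real.log p) :
    legendre (betaTilde1 p A) α ≤ 0 := by
  have hp1 : 0 < 1 - p := by linarith
  refine legendre_betaTilde1_nonpos_of_le_rpow hA hp hp2 fun u hu => ?_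
  refine (legendre_betaTilde1_le hβ (Or.inl (by linarith : -u ≤ 0))).trans_eq ?_
  have h1 : 1 + (p / (1 - p)) ^ u = p ^ u * (p ^ (-u) + (1 - p) ^ (-u)) := by
    rw [Real.div_rpow hp.le hp1.le, Real.rpow_neg hp.le, Real.rpow_neg hp1.le]
    field_simp
  rw [h1, Real.log_mul (by positivity) (by positivity), Real.log_rpow hp, betaFn,
    eq_div_iff hA.ne', sub_mul, div_mul_cancel₀ _ hA.ne', mul_assoc, hα]
  ring

end LegendreLower

section Spectrum

variable {A B p q : ℝ} {N : ℕ → ℕ} {c r : ℕ → ℝ}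

lemma dimH_le_legendre
    (h : AlternatingBlocks A B p q N (fun k => c (k + 1)) (fun k => r (k + 1)))
    (hpq : -Real.log p / Real.log A < -Real.log (1 - q) / Real.log B)
    {μ : Measure ℝ} [IsProbabilityMeasure μ]
    (hμ : ∀ w : List Bool, μ (moranI c w) = ENNReal.ofReal (cylMass r w 1 1))
    {α : ℝ} (hα : ∀ s, betaFn p A s ≤ s * α) :
    dimH {x | x ∈ moranSet c ∧ lowerLocalDim μ x = α} ≤
      ENNReal.ofReal (legendre (betaTilde1 p A) α) := by
  have hle := fun {s : ℝ} hs => dimH_le_sub_betaFn h hpq hμ hα (s := s) hs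
  set D := dimH {x | x ∈ moranSet c ∧ lowerLocalDim μ x = α}
  have hD : D ≠ ⊤ := ne_top_of_le_ne_top ENNReal.ofReal_ne_top (hle (Or.inl le_rfl))
  have hreal : ∀ {s : ℝ}, s ≤ 0 ∨ 1 ≤ s → D.toReal ≤ s * α - betaFn p A s := fun {s} hs =>
    ENNReal.toReal_le_of_le_ofReal (by linarith [hα s]) (hle hs)
  rw [← ENNReal.ofReal_toReal hD]
  refine ENNReal.ofReal_le_ofReal (le_ciInf fun s => ?_)
  by_cases hs : s ≤ 0 ∨ 1 ≤ s
  · rw [betaTilde1_of_or hs]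
    exact hreal hs
  · rw [betaTilde1_of_not hs]
    push Not at hs
    have h0 := mul_le_mul_of_nonneg_left (hreal (Or.inl le_rfl)) (by linarith : 0 ≤ 1 - s)
    have h1 := mul_le_mul_of_nonneg_left (hreal (Or.inr le_rfl)) hs.1.le
    linarith

lemma legendre_le_dimH
    (h : AlternatingBlocks A B p q N (fun k => c (k + 1)) (fun k => r (k + 1)))
    (hpq : -Real.log p / Real.log A < -Real.log (1 - q) / Real.log B)
    {μ : Measure ℝ} [IsProbabilityMeasure μ]
    (hμ : ∀ w : List Bool, μ (moranI c w) = ENNReal.ofReal (cylMass r w 1 1))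
    {α : ℝ} (hα1 : -Real.log (1 - p) / Real.log A ≤ α) (hα2 : α ≤ -Real.log p / Real.log A) :
    ENNReal.ofReal (legendre (betaTilde1 p A) α) ≤
      dimH {x | x ∈ moranSet c ∧ lowerLocalDim μ x = α} := by
  have hA := h.log_A_pos
  have hp0 := h.p_pos
  have hp2 := h.p_le
  have hβ : ∀ s, betaFn p A s ≤ s * α := betaFn_le hA hp0 (by linarith) hα1 hα2
  have hα1' := (div_le_iff₀ hA).1 hα1
  have hα2' := (le_div_iff₀ hA).1 hα2
  have hzero : legendre (betaTilde1 p A) α ≤ Real.log 2 / Real.log A := by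
    refine (legendre_betaTilde1_le hβ (Or.inl le_rfl)).trans_eq ?_
    rw [betaFn_zero]
    ring
  have hone : legendre (betaTilde1 p A) α ≤ α := by
    refine (legendre_betaTilde1_le hβ (Or.inr le_rfl)).trans_eq ?_
    rw [betaFn_one]
    ring
  have hcancel : ∀ x : ℝ, x / Real.log A * Real.log A = x := fun x => div_mul_cancel₀ x hA.ne'
  rcases eq_or_lt_of_le hp2 with rfl | hp2'
  · have e1 : Real.log (1 - 1 / 2) = -Real.log 2 := by
      rw [show (1 : ℝ) - 1 / 2 = 2⁻¹ by norm_num, Real.log_inv]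
    have e2 : Real.log (1 / 2) = -Real.log 2 := by rw [one_div, Real.log_inv]
    rw [e1] at hα1'
    rw [e2] at hα2'
    refine (ENNReal.ofReal_le_ofReal hzero).trans (ofReal_le_dimH_of_block_weight h hpq hμ hα2
      (τ := 1 / 2) (by norm_num) (by norm_num) ?_ ?_)
    · rw [crossEnt_half]; linarith
    · rw [crossEnt_half, hcancel]
  set κ := Real.log (1 - p) - Real.log p with hκ
  have hκ0 : 0 < κ := sub_pos.2 (Real.log_lt_log hp0 (by linarith))
  set τ := (α * Real.log A + Real.log (1 - p)) / κ with hτ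
  have hτκ : τ * κ = α * Real.log A + Real.log (1 - p) := div_mul_cancel₀ _ hκ0.ne'
  have hατ : α * Real.log A = crossEnt τ p := by rw [crossEnt_eq]; linarith
  have hτ0 : 0 ≤ τ := div_nonneg (by linarith) hκ0.le
  have hτ1 : τ ≤ 1 := (div_le_one hκ0).2 (by linarith)
  rcases eq_or_lt_of_le hτ0 with h0 | h0
  · have hle := legendre_betaTilde1_nonpos_left hA hp0 hp2' hβ
      (by rw [hατ, ← h0, crossEnt_eq]; ring)
    rw [ENNReal.ofReal_of_nonpos hle]
    exact zero_le
  rcases eq_or_lt_of_le hτ1 with h1 | h1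
  · have hle := legendre_betaTilde1_nonpos_right hA hp0 hp2' hβ
      (by rw [hατ, h1, crossEnt_eq]; ring)
    rw [ENNReal.ofReal_of_nonpos hle]
    exact zero_le
  obtain ⟨s, hs, hs0, hs1⟩ := exists_mul_sub_betaFn_eq hA hp0 hp2' h0 h1 hατ
  by_cases hτp : 1 / 2 ≤ τ ∨ τ ≤ p
  · refine le_trans (ENNReal.ofReal_le_ofReal ?_)
      (ofReal_le_dimH_of_block_weight h hpq hμ hα2 h0 h1 hατ (hcancel _))
    rw [← hs]
    exact legendre_betaTilde1_le hβ (hτp.imp hs0 hs1)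
  · push Not at hτp
    refine ofReal_le_dimH_of_adaptive_weight h hpq hμ hα2 ?_ ?_ hone ((le_div_iff₀ hA).1 hzero)
    · rw [hατ, crossEnt_eq, crossEnt_eq]
      linarith [mul_lt_mul_of_pos_right hτp.2 hκ0]
    · rw [hατ]
      exact crossEnt_mono hp0 hp2 hτp.1.le

end Spectrum

end MoranSpectrum

/-- for every α with −log(1−p)/log A ≤ α ≤ −log p/log A, the Hausdorff
dimension of E̲(μ,α) equals the Legendre transform of the modified function β̃₁. -/
theorem stmt_8 (A B p q : ℝ) (N : ℕ → ℕ)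
    (hBA : B < A) (hB2 : 2 < B)
    (hp0 : 0 < p) (hp2 : p ≤ 1 / 2) (hq0 : 0 < q) (hq2 : q ≤ 1 / 2)
    (hN0 : N 0 = 0) (hNmono : StrictMono N)
    (hNlim : Tendsto (fun i : ℕ => (N (i + 1) : ℝ) / (N i : ℝ)) atTop atTop)
    (hpq : -Real.log p / Real.log A < -Real.log (1 - q) / Real.log B)
    (c r : ℕ → ℝ)
    (hcA : ∀ i n : ℕ, N (2 * i) < n → n ≤ N (2 * i + 1) → c n = A)
    (hcB : ∀ i n : ℕ, N (2 * i + 1) < n → n ≤ N (2 * i + 2) → c n = B)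
    (hrp : ∀ i n : ℕ, N (2 * i) < n → n ≤ N (2 * i + 1) → r n = p)
    (hrq : ∀ i n : ℕ, N (2 * i + 1) < n → n ≤ N (2 * i + 2) → r n = q)
    (μ : Measure ℝ) [IsProbabilityMeasure μ]
    (hμ : ∀ w : List Bool, μ (moranI c w) = ENNReal.ofReal (cylMass r w 1 1))
    (α : ℝ)
    (hα1 : -Real.log (1 - p) / Real.log A ≤ α)
    (hα2 : α ≤ -Real.log p / Real.log A) :
    dimH {x | x ∈ moranSet c ∧ lowerLocalDim μ x = α} =
      ENNReal.ofReal (legendre (betaTilde1 p A) α) := by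
  have h : MoranSpectrum.AlternatingBlocks A B p q N (fun k => c (k + 1)) (fun k => r (k + 1)) :=
    { lt := hBA
      two_lt := hB2
      p_pos := hp0
      p_le := hp2
      q_pos := hq0
      q_le := hq2
      zero := hN0
      mono := hNmono
      lim := hNlim
      first := fun i k h1 h2 =>
        ⟨hcA i (k + 1) (Nat.lt_succ_of_le h1) h2, hrp i (k + 1) (Nat.lt_succ_of_le h1) h2⟩
      second := fun i k h1 h2 =>
        ⟨hcB i (k + 1) (Nat.lt_succ_of_le h1) h2, hrq i (k + 1) (Nat.lt_succ_of_le h1) h2⟩ }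
  exact le_antisymm
    (MoranSpectrum.dimH_le_legendre h hpq hμ
      (MoranSpectrum.betaFn_le h.log_A_pos hp0 (by linarith) hα1 hα2))
    (MoranSpectrum.legendre_le_dimH h hpq hμ hα1 hα2)
end
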